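/- arXiv:1903.03416 — 3 statements merged into one kernel-verified Lean document; each statement's English description precedes it below -/
import Mathlib

section
/- Let 0 < ε ≤ 1/8, C₀ ≥ 1 and 0 ≤ θ ≤ 1/2. There is a constant C = C(ε, C₀) such that the following holds. Let p be an odd prime and let ψ_p denote the Legendre symbol mod p (a function ℕ → ℝ via reduction mod p). Let a : ℕ → ℝ satisfy ∑_{1 ≤ n ≤ X} a(n)² ≤ C₀ X (1 + log X) for all real X ≥ 1. Let M, N be real numbers with 1 ≤ M ≤ N, and let V₁, V₂ : ℝ → ℝ vanish outside [1,2] with |V₁|, |V₂| ≤ 1. Assume moreover that for i ∈ {1,2} and for X ∈ {M, N}: | ∑_{m ≥ 1} a(m) ψ_p(m) V_i(m/X) | ≤ C₀ ( X^{1/2} p^{3/8 + θ/4 + ε} + X^{3/8} p^{1/2 + ε} ). Then | (1/√(MN)) ∑ a(m) ψ_p(m) a(n) ψ_p(n) V₁(m/M) V₂(n/N) | ≤ C ( (MN)^{1/4} p^{3/8 + θ/4 + 2ε} + M^{3/16} N^{1/4} p^{7/16 + θ/8 + 2ε} + (MN)^{3/16} p^{1/2 + 2ε} ), where the sum runs over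 all pairs of positive integers (m, n) with m ≠ n and gcd(mn, p) = 1. -/
open Finset

lemma aux_zero (V : ℝ → ℝ) (hV : ∀ x : ℝ, x ∉ Set.Icc (1 : ℝ) 2 → V x = 0) (X : ℝ) (hX : 1 ≤ X)
    (m : ℕ) (hm : m ∉ Finset.Icc 1 ⌊2 * X⌋₊) (h1 : 1 ≤ m) : V ((m : ℝ) / X) = 0 := by
  apply hV
  intro h
  apply hm
  rw [Finset.mem_Icc]
  refine ⟨h1, Nat.le_floor ?_⟩
  have := h.2
  rwa [div_le_iff₀ (by linarith)] at this

lemma aux_triv (C₀ : ℝ) (a c : ℕ → ℝ) (hc : ∀ n, |c n| ≤ 1)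
    (ha : ∀ X : ℝ, 1 ≤ X → ∑ n ∈ Finset.Icc 1 ⌊X⌋₊, (a n)^2 ≤ C₀ * X * (1 + Real.log X))
    (X : ℝ) (hX : 1 ≤ X) :
    (∑ n ∈ Finset.Icc 1 ⌊2 * X⌋₊, a n * c n)^2 ≤ 4 * C₀ * X^2 * (1 + Real.log (2 * X)) := by
  have h1 : (∑ n ∈ Finset.Icc 1 ⌊2 * X⌋₊, a n * c n)^2
      ≤ (#(Finset.Icc 1 ⌊2 * X⌋₊) : ℝ) * ∑ n ∈ Finset.Icc 1 ⌊2 * X⌋₊, (a n * c n)^2 :=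
    sq_sum_le_card_mul_sum_sq
  have h2 : ∑ n ∈ Finset.Icc 1 ⌊2 * X⌋₊, (a n * c n)^2 ≤ ∑ n ∈ Finset.Icc 1 ⌊2 * X⌋₊, (a n)^2 := by
    apply Finset.sum_le_sum
    intro n _
    rw [mul_pow]
    have : c n ^ 2 ≤ 1 := by
      rw [sq_le_one_iff_abs_le_one]; exact hc n
    nlinarith [sq_nonneg (a n)]
  have h3 := ha (2 * X) (by linarith)
  have h4 : (#(Finset.Icc 1 ⌊2 * X⌋₊) : ℝ) ≤ 2 * X := by
    rw [Nat.card_Icc]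
    simpa using Nat.floor_le (by linarith : 0 ≤ 2 * X)
  have h5 : 0 ≤ ∑ n ∈ Finset.Icc 1 ⌊2 * X⌋₊, (a n * c n)^2 := Finset.sum_nonneg (fun _ _ => sq_nonneg _)
  calc _ ≤ _ := h1
    _ ≤ (2 * X) * (C₀ * (2 * X) * (1 + Real.log (2 * X))) :=
      mul_le_mul h4 (h2.trans h3) h5 (by linarith)
    _ = _ := by ring

lemma aux_diag (C₀ : ℝ) (a c : ℕ → ℝ) (hc : ∀ n, |c n| ≤ 1)
    (ha : ∀ X : ℝ, 1 ≤ X → ∑ n ∈ Finset.Icc 1 ⌊X⌋₊, (a n)^2 ≤ C₀ * X * (1 + Real.log X))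
    (X : ℝ) (hX : 1 ≤ X) :
    |∑ n ∈ Finset.Icc 1 ⌊2 * X⌋₊, a n ^ 2 * c n| ≤ C₀ * (2 * X) * (1 + Real.log (2 * X)) := by
  refine (Finset.abs_sum_le_sum_abs _ _).trans (le_trans ?_ (ha (2 * X) (by linarith)))
  apply Finset.sum_le_sum
  intro n _
  rw [abs_mul, abs_of_nonneg (sq_nonneg (a n))]
  exact mul_le_of_le_one_right (sq_nonneg _) (hc n)

lemma aux_prod (f g : ℕ → ℝ) (A B : Finset ℕ) (hAB : A ⊆ B) :
    ∑ mn ∈ A ×ˢ B, (if mn.1 ≠ mn.2 then f mn.1 * g mn.2 else 0)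
      = (∑ m ∈ A, f m) * (∑ n ∈ B, g n) - ∑ m ∈ A, f m * g m := by
  rw [eq_sub_iff_add_eq, Finset.sum_mul_sum, Finset.sum_product, ← Finset.sum_add_distrib]
  apply Finset.sum_congr rfl
  intro m hm
  have : f m * g m = ∑ n ∈ B, if m = n then f m * g n else 0 := by
    rw [Finset.sum_ite_eq, if_pos (hAB hm)]
  rw [this, ← Finset.sum_add_distrib]
  apply Finset.sum_congr rfl
  intro n _
  by_cases h : m = n <;> simp [h]

lemma aux_log (M : ℝ) (hM : 1 ≤ M) : 1 + Real.log (2 * M) ≤ 3 * M ^ ((1:ℝ)/2) := by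
  rw [← Real.sqrt_eq_rpow]
  have h0 : 0 < Real.sqrt M := Real.sqrt_pos.2 (by linarith)
  have h2 : Real.log (2 * M) = Real.log 2 + 2 * Real.log (Real.sqrt M) := by
    rw [Real.log_mul (by norm_num) (by linarith), Real.log_sqrt (by linarith)]; ring
  have h3 := Real.log_le_sub_one_of_pos h0
  have h4 := Real.log_two_lt_d9
  linarith

/-- The purely algebraic part. -/
lemma aux_alg (C₀ L x y s r g K S1 S2 D : ℝ) (hC : 1 ≤ C₀) (hx : 1 ≤ x) (hxy : x ≤ y)
    (hs : 1 ≤ s) (hr : 1 ≤ r) (hg : 1 ≤ g) (hK : 1 ≤ K) (hL : 1 ≤ L)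
    (h1 : |S1| ≤ C₀ * (x^8 * s^2 + x^6 * r^2)) (h2 : |S2| ≤ C₀ * (y^8 * s^2 + y^6 * r^2))
    (t1 : S1^2 ≤ 4 * C₀ * (x^16)^2 * L) (t2 : S2^2 ≤ 4 * C₀ * (y^16)^2 * L)
    (hD : |D| ≤ C₀ * (2 * x^16) * (3 * x^8))
    (hcase : L ≤ K * g ∨ (s^2 ≤ y^4 ∧ r^2 ≤ y^4)) :
    |S1 * S2 - D| ≤ x^8*y^8 * ((12 * C₀^2 * K) *
      (x^4*y^4*(s^2*g) + x^3*y^4*(s*r*g) + x^3*y^3*(r^2*g))) := by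
  have hy : 1 ≤ y := hx.trans hxy
  have x0 : 0 < x := by linarith
  have y0 : 0 < y := by linarith
  have s0 : 0 < s := by linarith
  have r0 : 0 < r := by linarith
  have g0 : 0 < g := by linarith
  have C0 : 0 < C₀ := by linarith
  have K0 : 0 < K := by linarith
  set E := x^4*y^4*s^2 + x^3*y^4*(s*r) + x^3*y^3*r^2 with hE
  have E0 : 0 < E := by positivity
  have hEg : x^4*y^4*(s^2*g) + x^3*y^4*(s*r*g) + x^3*y^3*(r^2*g) = E * g := by rw [hE]; ring
  rw [hEg]
  -- diagonal
  have d1 : |D| ≤ x^8*y^8 * (6 * C₀^2 * K * (E * g)) := by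
    have e1 : x^4*y^4 ≤ E := by
      have : x^4*y^4*1 ≤ x^4*y^4*s^2 := by gcongr; exact one_le_pow₀ hs
      have : 0 < x^3*y^4*(s*r) := by positivity
      have : 0 < x^3*y^3*r^2 := by positivity
      linarith
    have e2 : C₀ ≤ C₀^2 * K * g := by
      calc C₀ = C₀ * 1 * 1 * 1 := by ring
        _ ≤ C₀ * C₀ * K * g := by gcongr
        _ = _ := by ring
    calc |D| ≤ C₀ * (2 * x^16) * (3 * x^8) := hD
      _ = 6 * C₀ * (x^8 * x^8 * (x^4 * x^4)) := by ring
      _ ≤ 6 * (C₀^2 * K * g) * (x^8 * y^8 * (x^4 * y^4)) := by gcongr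
      _ ≤ 6 * (C₀^2 * K * g) * (x^8 * y^8 * E) := by gcongr
      _ = _ := by ring
  have b1 : |S1 * S2| ≤ 2 * C₀^2 * E^2 := by
    have e1 : x^8*y^8*s^4 + x^6*y^8*(s*r)^2 + x^6*y^6*r^4 ≤ E^2 := by
      have : E^2 - (x^8*y^8*s^4 + x^6*y^8*(s*r)^2 + x^6*y^6*r^4)
        = 2 * ((x^4*y^4*s^2) * (x^3*y^4*(s*r)) + (x^4*y^4*s^2) * (x^3*y^3*r^2)
          + (x^3*y^4*(s*r)) * (x^3*y^3*r^2)) := by rw [hE]; ring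
      have : 0 < 2 * ((x^4*y^4*s^2) * (x^3*y^4*(s*r)) + (x^4*y^4*s^2) * (x^3*y^3*r^2)
          + (x^3*y^4*(s*r)) * (x^3*y^3*r^2)) := by positivity
      linarith
    have e2 : x^6*y^6*x^2*(s*r)^2 ≤ x^6*y^6*y^2*(s*r)^2 := by gcongr
    have e3 : 0 < x^8*y^8*s^4 := by positivity
    have e4 : 0 < x^6*y^6*r^4 := by positivity
    rw [abs_mul]
    calc |S1| * |S2| ≤ (C₀ * (x^8 * s^2 + x^6 * r^2)) * (C₀ * (y^8 * s^2 + y^6 * r^2)) :=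
          mul_le_mul h1 h2 (abs_nonneg _) (by positivity)
      _ = C₀^2 * (x^8*y^8*s^4 + x^6*y^6*x^2*(s*r)^2 + x^6*y^6*y^2*(s*r)^2 + x^6*y^6*r^4) := by ring
      _ ≤ C₀^2 * (2 * E^2) := by
        apply mul_le_mul_of_nonneg_left _ (by positivity)
        nlinarith
      _ = _ := by ring
  have b2 : |S1 * S2| ≤ x^8*y^8 * (6 * C₀^2 * K * (E * g)) := by
    rcases hcase with h | ⟨hs4, hr4⟩
    · have e1 : |S1 * S2| ≤ 4 * C₀ * (x^16 * y^16) * L := by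
        refine abs_le_of_sq_le_sq ?_ (by positivity)
        rw [mul_pow]
        calc S1^2 * S2^2 ≤ (4 * C₀ * (x^16)^2 * L) * (4 * C₀ * (y^16)^2 * L) :=
              mul_le_mul t1 t2 (sq_nonneg _) (by positivity)
          _ = _ := by ring
      refine abs_le_of_sq_le_sq ?_ (by positivity)
      calc (S1*S2)^2 = |S1 * S2| * |S1 * S2| := by rw [← sq, sq_abs]
        _ ≤ (2 * C₀^2 * E^2) * (4 * C₀ * (x^16 * y^16) * L) :=
            mul_le_mul b1 e1 (abs_nonneg _) (by positivity)
        _ = 8 * C₀^2 * C₀ * 1 * E^2 * (x^16 * y^16) * (L * 1) := by ring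
        _ ≤ 36 * C₀^2 * C₀ * C₀ * E^2 * (x^16 * y^16) * ((K * g) * (K * g)) := by
            gcongr
            · norm_num
            · exact hL.trans h
        _ = _ := by ring
    · have e1 : E ≤ 3 * (x^8 * y^8) := by
        have q1 : s * r ≤ y^4 := by nlinarith [sq_nonneg (s - r)]
        have hx34 : x^3 ≤ x^8 := pow_le_pow_right₀ hx (by norm_num)
        have hx48 : x^4 ≤ x^8 := pow_le_pow_right₀ hx (by norm_num)
        have hy34 : y^3 ≤ y^4 := pow_le_pow_right₀ hy (by norm_num)
        calc E ≤ x^8*y^4*y^4 + x^8*y^4*y^4 + x^8*y^4*y^4 := by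
              rw [hE]; gcongr
          _ = _ := by ring
      calc |S1 * S2| ≤ 2 * C₀^2 * E^2 := b1
        _ = 2 * C₀^2 * (E * E) * (1 * 1) := by ring
        _ ≤ 2 * C₀^2 * (E * (3 * (x^8*y^8))) * (K * g) := by gcongr
        _ = _ := by ring
  calc |S1 * S2 - D| ≤ |S1 * S2| + |D| := abs_sub _ _
    _ ≤ _ := by linarith

/-- Lemma "tilde1": the bound for the quadratically twisted sum `𝒮̃_{N,M,p,1}`,
for sequences satisfying the Rankin–Selberg bound and the Burgess-quality twisted
linear-sum bound of Lemma "kiraltwist" taken as a hypothesis. -/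
theorem stmt5 (ε C₀ θ : ℝ) (hε : 0 < ε) (hε' : ε ≤ 1/8) (hC₀ : 1 ≤ C₀)
    (hθ0 : 0 ≤ θ) (hθ : θ ≤ 1/2) :
    ∃ C : ℝ, 0 < C ∧
    ∀ (p : ℕ) [Fact p.Prime], Odd p →
    ∀ a : ℕ → ℝ,
      (∀ X : ℝ, 1 ≤ X → ∑ n ∈ Finset.Icc 1 ⌊X⌋₊, (a n)^2 ≤ C₀ * X * (1 + Real.log X)) →
      ∀ M N : ℝ, 1 ≤ M → M ≤ N →
      ∀ V₁ V₂ : ℝ → ℝ,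
        (∀ x : ℝ, x ∉ Set.Icc (1 : ℝ) 2 → V₁ x = 0) → (∀ x : ℝ, |V₁ x| ≤ 1) →
        (∀ x : ℝ, x ∉ Set.Icc (1 : ℝ) 2 → V₂ x = 0) → (∀ x : ℝ, |V₂ x| ≤ 1) →
        (∀ V : ℝ → ℝ, (V = V₁ ∨ V = V₂) → ∀ X : ℝ, (X = M ∨ X = N) →
          |∑' m : ℕ, (if 1 ≤ m then a m * (legendreSym p m : ℝ) * V ((m : ℝ) / X) else 0)|
            ≤ C₀ * (X ^ ((1 : ℝ)/2) * (p : ℝ) ^ ((3 : ℝ)/8 + θ/4 + ε)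
                + X ^ ((3 : ℝ)/8) * (p : ℝ) ^ ((1 : ℝ)/2 + ε))) →
        |(1 / Real.sqrt (M * N)) * ∑' mn : ℕ × ℕ,
            (if 1 ≤ mn.1 ∧ 1 ≤ mn.2 ∧ mn.1 ≠ mn.2 ∧ Nat.Coprime (mn.1 * mn.2) p
             then a mn.1 * (legendreSym p mn.1 : ℝ) * a mn.2 * (legendreSym p mn.2 : ℝ)
                * V₁ ((mn.1 : ℝ) / M) * V₂ ((mn.2 : ℝ) / N) else 0)|
        ≤ C * ((M * N) ^ ((1 : ℝ)/4) * (p : ℝ) ^ ((3 : ℝ)/8 + θ/4 + 2*ε)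
              + M ^ ((3 : ℝ)/16) * N ^ ((1 : ℝ)/4) * (p : ℝ) ^ ((7 : ℝ)/16 + θ/8 + 2*ε)
              + (M * N) ^ ((3 : ℝ)/16) * (p : ℝ) ^ ((1 : ℝ)/2 + 2*ε)) := by
  refine ⟨12 * C₀^2 * (2 + 4 / ε), by positivity, ?_⟩
  intro p hp hodd a ha M N hM hMN V₁ V₂ hV₁ hV₁' hV₂ hV₂' hS
  have hN : 1 ≤ N := hM.trans hMN
  have M0 : 0 < M := by linarith
  have N0 : 0 < N := by linarith
  have hp1 : (1:ℝ) ≤ p := by exact_mod_cast hp.out.one_le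
  have p0 : (0:ℝ) < p := by linarith
  have hchi : ∀ m : ℕ, |(legendreSym p m : ℝ)| ≤ 1 := by
    intro m
    by_cases h : ((m : ℤ) : ZMod p) = 0
    · rw [(legendreSym.eq_zero_iff p m).2 h]; simp
    · rcases legendreSym.eq_one_or_neg_one p h with h | h <;> rw [h] <;> simp
  have hts : ∀ (V : ℝ → ℝ) (hV : ∀ x : ℝ, x ∉ Set.Icc (1 : ℝ) 2 → V x = 0) (X : ℝ) (hX : 1 ≤ X),
      (∑' m : ℕ, (if 1 ≤ m then a m * (legendreSym p m : ℝ) * V ((m : ℝ) / X) else 0))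
        = ∑ m ∈ Finset.Icc 1 ⌊2 * X⌋₊, a m * ((legendreSym p m : ℝ) * V ((m : ℝ) / X)) := by
    intro V hV X hX
    rw [tsum_eq_sum (s := Finset.Icc 1 ⌊2 * X⌋₊)]
    · apply Finset.sum_congr rfl
      intro m hm
      rw [if_pos (Finset.mem_Icc.1 hm).1]; ring
    · intro m hm
      split_ifs with h
      · rw [aux_zero V hV X hX m hm h]; ring
      · rfl
  have H1 := hS V₁ (Or.inl rfl) M (Or.inl rfl)
  have H2 := hS V₂ (Or.inr rfl) N (Or.inr rfl)
  rw [hts V₁ hV₁ M hM] at H1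
  rw [hts V₂ hV₂ N hN] at H2
  have hb : ∀ (V : ℝ → ℝ) (hV : ∀ x : ℝ, |V x| ≤ 1) (X : ℝ) (m : ℕ),
      |(legendreSym p m : ℝ) * V ((m : ℝ) / X)| ≤ 1 := by
    intro V hV X m
    rw [abs_mul]
    exact mul_le_one₀ (hchi m) (abs_nonneg _) (hV _)
  have T1 := aux_triv C₀ a _ (hb V₁ hV₁' M) ha M hM
  have T2 := aux_triv C₀ a _ (hb V₂ hV₂' N) ha N hN
  have DD := aux_diag C₀ a (fun m => ((legendreSym p m : ℝ) * V₁ ((m : ℝ) / M)) *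
    ((legendreSym p m : ℝ) * V₂ ((m : ℝ) / N)))
    (fun m => by
      rw [abs_mul]
      exact mul_le_one₀ (hb V₁ hV₁' M m) (abs_nonneg _) (hb V₂ hV₂' N m)) ha M hM
  have hmain : (∑' mn : ℕ × ℕ,
            (if 1 ≤ mn.1 ∧ 1 ≤ mn.2 ∧ mn.1 ≠ mn.2 ∧ Nat.Coprime (mn.1 * mn.2) p
             then a mn.1 * (legendreSym p mn.1 : ℝ) * a mn.2 * (legendreSym p mn.2 : ℝ)
                * V₁ ((mn.1 : ℝ) / M) * V₂ ((mn.2 : ℝ) / N) else 0))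
      = (∑ m ∈ Finset.Icc 1 ⌊2 * M⌋₊, a m * ((legendreSym p m : ℝ) * V₁ ((m : ℝ) / M))) *
        (∑ m ∈ Finset.Icc 1 ⌊2 * N⌋₊, a m * ((legendreSym p m : ℝ) * V₂ ((m : ℝ) / N)))
        - ∑ m ∈ Finset.Icc 1 ⌊2 * M⌋₊, a m ^ 2 * (((legendreSym p m : ℝ) * V₁ ((m : ℝ) / M)) *
    ((legendreSym p m : ℝ) * V₂ ((m : ℝ) / N))) := by
    have hsub : Finset.Icc 1 ⌊2 * M⌋₊ ⊆ Finset.Icc 1 ⌊2 * N⌋₊ :=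
      Finset.Icc_subset_Icc le_rfl (Nat.floor_le_floor (by linarith))
    rw [tsum_eq_sum (s := Finset.Icc 1 ⌊2 * M⌋₊ ×ˢ Finset.Icc 1 ⌊2 * N⌋₊)]
    · have := aux_prod (fun m => a m * ((legendreSym p m : ℝ) * V₁ ((m : ℝ) / M)))
        (fun m => a m * ((legendreSym p m : ℝ) * V₂ ((m : ℝ) / N))) _ _ hsub
      have h2 : ∑ m ∈ Finset.Icc 1 ⌊2 * M⌋₊, a m ^ 2 * (((legendreSym p m : ℝ) * V₁ ((m : ℝ) / M)) *
          ((legendreSym p m : ℝ) * V₂ ((m : ℝ) / N)))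
          = ∑ m ∈ Finset.Icc 1 ⌊2 * M⌋₊, (a m * ((legendreSym p m : ℝ) * V₁ ((m : ℝ) / M))) *
            (a m * ((legendreSym p m : ℝ) * V₂ ((m : ℝ) / N))) :=
        Finset.sum_congr rfl (fun m _ => by ring)
      rw [h2, ← this]
      apply Finset.sum_congr rfl
      rintro ⟨m, n⟩ hmn
      rw [Finset.mem_product, Finset.mem_Icc, Finset.mem_Icc] at hmn
      obtain ⟨⟨hm, -⟩, ⟨hn, -⟩⟩ := hmn
      dsimp only at hm hn ⊢
      by_cases hne : m = n
      · simp [hne]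
      by_cases hc : Nat.Coprime (m * n) p
      · rw [if_pos ⟨hm, hn, hne, hc⟩, if_pos hne]; ring
      · rw [if_neg (fun h => hc h.2.2.2), if_pos hne]
        have hd : p ∣ m * n := by
          by_contra h
          exact hc ((Nat.Prime.coprime_iff_not_dvd hp.out).2 h).symm
        rcases (Nat.Prime.dvd_mul hp.out).1 hd with h | h
        · have : legendreSym p m = 0 := by
            rw [legendreSym.eq_zero_iff]
            simpa using (ZMod.natCast_eq_zero_iff m p).2 h
          rw [this]; simp
        · have : legendreSym p n = 0 := by
            rw [legendreSym.eq_zero_iff]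
            simpa using (ZMod.natCast_eq_zero_iff n p).2 h
          rw [this]; simp
    · rintro ⟨m, n⟩ hmn
      dsimp only
      split_ifs with h
      · obtain ⟨hm, hn, -, -⟩ := h
        rw [Finset.mem_product, not_and_or] at hmn
        rcases hmn with h | h
        · rw [aux_zero V₁ hV₁ M hM m h hm]; ring
        · rw [aux_zero V₂ hV₂ N hN n h hn]; ring
      · rfl
  rw [hmain]
  generalize (∑ m ∈ Finset.Icc 1 ⌊2 * M⌋₊, a m * ((legendreSym p m : ℝ) * V₁ ((m : ℝ) / M))) = S1 at *
  generalize (∑ m ∈ Finset.Icc 1 ⌊2 * N⌋₊, a m * ((legendreSym p m : ℝ) * V₂ ((m : ℝ) / N))) = S2 at *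
  generalize (∑ m ∈ Finset.Icc 1 ⌊2 * M⌋₊, a m ^ 2 * (((legendreSym p m : ℝ) * V₁ ((m : ℝ) / M)) *
    ((legendreSym p m : ℝ) * V₂ ((m : ℝ) / N)))) = D at *
  have hpw : ∀ (z : ℝ) (hz : 0 < z) (k : ℕ) (e f : ℝ), f * k = e → z ^ e = (z ^ f) ^ k := by
    intro z hz k e f h
    rw [← Real.rpow_mul_natCast hz.le, h]
  have hL : Real.log (2 * M) ≤ Real.log (2 * N) := Real.log_le_log (by linarith) (by linarith)
  have hL1 : 0 ≤ Real.log (2 * N) := Real.log_nonneg (by linarith)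
  set x := M ^ ((1:ℝ)/16) with hx
  set y := N ^ ((1:ℝ)/16) with hy
  set s := (p:ℝ) ^ (((3 : ℝ)/8 + θ/4 + ε)/2) with hs
  set r := (p:ℝ) ^ (((1 : ℝ)/2 + ε)/2) with hr
  set g := (p:ℝ) ^ ε with hg
  have x1 : 1 ≤ x := Real.one_le_rpow hM (by norm_num)
  have y1 : 1 ≤ y := Real.one_le_rpow hN (by norm_num)
  have hxy : x ≤ y := Real.rpow_le_rpow M0.le hMN (by norm_num)
  have s1 : 1 ≤ s := Real.one_le_rpow hp1 (by linarith)
  have r1 : 1 ≤ r := Real.one_le_rpow hp1 (by linarith)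
  have g1 : 1 ≤ g := Real.one_le_rpow hp1 hε.le
  have eM : M = x ^ 16 := by
    rw [hx, ← hpw M M0 16 1 _ (by norm_num), Real.rpow_one]
  have eN : N = y ^ 16 := by
    rw [hy, ← hpw N N0 16 1 _ (by norm_num), Real.rpow_one]
  have eM2 : M ^ ((1:ℝ)/2) = x ^ 8 := hpw M M0 8 _ _ (by norm_num)
  have eN2 : N ^ ((1:ℝ)/2) = y ^ 8 := hpw N N0 8 _ _ (by norm_num)
  have eM3 : M ^ ((3:ℝ)/8) = x ^ 6 := hpw M M0 6 _ _ (by norm_num)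
  have eN3 : N ^ ((3:ℝ)/8) = y ^ 6 := hpw N N0 6 _ _ (by norm_num)
  have eM4 : M ^ ((1:ℝ)/4) = x ^ 4 := hpw M M0 4 _ _ (by norm_num)
  have eN4 : N ^ ((1:ℝ)/4) = y ^ 4 := hpw N N0 4 _ _ (by norm_num)
  have eM5 : M ^ ((3:ℝ)/16) = x ^ 3 := hpw M M0 3 _ _ (by norm_num)
  have eN5 : N ^ ((3:ℝ)/16) = y ^ 3 := hpw N N0 3 _ _ (by norm_num)
  have eP : (p:ℝ) ^ ((3 : ℝ)/8 + θ/4 + ε) = s ^ 2 := hpw _ p0 2 _ _ (by push_cast; ring)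
  have eQ : (p:ℝ) ^ ((1 : ℝ)/2 + ε) = r ^ 2 := hpw _ p0 2 _ _ (by push_cast; ring)
  have eP2 : (p:ℝ) ^ ((3 : ℝ)/8 + θ/4 + 2*ε) = s ^ 2 * g := by
    rw [← eP, hg, ← Real.rpow_add p0]; congr 1; ring
  have eQ2 : (p:ℝ) ^ ((1 : ℝ)/2 + 2*ε) = r ^ 2 * g := by
    rw [← eQ, hg, ← Real.rpow_add p0]; congr 1; ring
  have eR2 : (p:ℝ) ^ ((7 : ℝ)/16 + θ/8 + 2*ε) = s * r * g := by
    rw [hs, hr, hg, ← Real.rpow_add p0, ← Real.rpow_add p0]; congr 1; ring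
  have hlogM := aux_log M hM
  rw [eM2] at hlogM
  have hcase : 1 + Real.log (2 * N) ≤ (2 + 4 / ε) * g ∨ (s^2 ≤ y^4 ∧ r^2 ≤ y^4) := by
    rcases le_total N ((p:ℝ)^4) with h | h
    · left
      have h1 : Real.log N ≤ 4 * Real.log p := by
        have := Real.log_le_log N0 h
        rwa [Real.log_pow] at this
      have h2 : Real.log p ≤ g / ε := Real.log_le_rpow_div p0.le hε
      rw [Real.log_mul (by norm_num) N0.ne']
      have h3 := Real.log_two_lt_d9
      have : (2 + 4 / ε) * g = 2 * g + 4 * (g / ε) := by ring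
      linarith
    · right
      have h1 : (p:ℝ) ≤ y ^ 4 := by
        have q0 : 0 < y := by linarith
        rw [eN] at h
        have : (p:ℝ)^4 ≤ (y^4)^4 := by rw [← pow_mul]; exact h
        exact le_of_pow_le_pow_left₀ (by norm_num) (by positivity) this
      constructor
      · rw [← eP]
        refine le_trans ?_ h1
        conv_rhs => rw [← Real.rpow_one (p:ℝ)]
        exact Real.rpow_le_rpow_of_exponent_le hp1 (by linarith)
      · rw [← eQ]
        refine le_trans ?_ h1
        conv_rhs => rw [← Real.rpow_one (p:ℝ)]
        exact Real.rpow_le_rpow_of_exponent_le hp1 (by linarith)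
  rw [eM2, eM3, eP, eQ] at H1
  rw [eN2, eN3, eP, eQ] at H2
  have T1' : S1 ^ 2 ≤ 4 * C₀ * (x^16)^2 * (1 + Real.log (2 * N)) := by
    rw [← eM]
    refine T1.trans ?_
    gcongr
  have T2' : S2 ^ 2 ≤ 4 * C₀ * (y^16)^2 * (1 + Real.log (2 * N)) := by
    rw [← eN]; exact T2
  have D' : |D| ≤ C₀ * (2 * x^16) * (3 * x^8) := by
    rw [← eM]
    refine DD.trans ?_
    gcongr
  have hK : 1 ≤ 2 + 4 / ε := by
    have : 0 < 4 / ε := by positivity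
    linarith
  have key := aux_alg C₀ (1 + Real.log (2 * N)) x y s r g (2 + 4 / ε) S1 S2 D hC₀ x1 hxy s1 r1 g1
    hK (by linarith) H1 H2 T1' T2' D' hcase
  have hsq : Real.sqrt (M * N) = x^8 * y^8 := by
    rw [Real.sqrt_eq_rpow, Real.mul_rpow M0.le N0.le, eM2, eN2]
  rw [Real.mul_rpow M0.le N0.le, Real.mul_rpow M0.le N0.le, eM4, eN4, eM5, eN5, eP2, eQ2, eR2, hsq]
  have hpos : 0 < x^8 * y^8 := by positivity
  rw [abs_mul, abs_of_pos (by positivity), one_div, inv_mul_le_iff₀ hpos]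
  exact key
end

section
/- Let p be an odd prime and let m, n be integers with p ∤ mn. If the Legendre symbol (mn|p) equals −1, then S(m, n; p) = 0. If (mn|p) = 1, then S(m, n; p) = (n|p) · ε_p · √p · ∑_{x ∈ ℤ/pℤ, x² = mn} e_p(2x), where ε_p = 1 if p ≡ 1 (mod 4) and ε_p = i if p ≡ 3 (mod 4). -/
open Finset

/-- `e_p(a) = exp(2πi ã / p)` for `a : ZMod p`. -/
noncomputable def ep (p : ℕ) (a : ZMod p) : ℂ :=
  Complex.exp (2 * Real.pi * Complex.I * (a.val : ℂ) / p)

/-- The Salié sum `S(m,n;p) = ∑_{x ∈ (ℤ/p)ˣ} (x|p) e_p(m x + n x⁻¹)`. -/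
noncomputable def salieSum (p : ℕ) [Fact p.Prime] (m n : ZMod p) : ℂ :=
  ∑ x : (ZMod p)ˣ, (legendreSym p ((x : ZMod p).val) : ℂ) *
    ep p (m * (x : ZMod p) + n * ((x⁻¹ : (ZMod p)ˣ) : ZMod p))


/-- q-binomials -/
def qb (q : ℂ) : ℕ → ℕ → ℂ
  | _, 0 => 1
  | 0, _ + 1 => 0
  | m + 1, j + 1 => qb q m j + q ^ (j + 1) * qb q m (j + 1)

lemma qb_zero (q : ℂ) (m : ℕ) : qb q m 0 = 1 := by cases m <;> rfl

lemma qb_succ (q : ℂ) (m j : ℕ) :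
    qb q (m + 1) (j + 1) = qb q m j + q ^ (j + 1) * qb q m (j + 1) := rfl

lemma qb_gt (q : ℂ) (m : ℕ) : ∀ j, m < j → qb q m j = 0 := by
  induction m with
  | zero => intro j hj; cases j with
    | zero => omega
    | succ j => rfl
  | succ m ih => intro j hj; cases j with
    | zero => omega
    | succ j => rw [qb_succ, ih j (by omega), ih (j + 1) (by omega)]; simp

lemma qb_abs (q : ℂ) (m : ℕ) : ∀ j,
    (1 - q ^ (j + 1)) * qb q (m + 1) (j + 1) = (1 - q ^ (m + 1)) * qb q m j := by
  induction m with
  | zero => intro j; cases j with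
    | zero => simp [qb]
    | succ j => simp [qb]
  | succ m ih =>
    intro j
    cases j with
    | zero =>
      have h0 := ih 0
      rw [qb_succ, qb_zero]
      rw [qb_zero] at h0
      linear_combination q * h0
    | succ j =>
      have h1 := ih (j + 1)
      have h2 := ih j
      have h3 := qb_succ q m j
      rw [qb_succ q (m+1) (j+1)]
      linear_combination q ^ (j + 2) * h1 + q * h2 - q * (1 - q ^ (m + 1)) * h3

lemma qb_alt (q : ℂ) (N m : ℕ) (h : m + 2 < N) :
    ∑ j ∈ range N, (-1) ^ j * qb q (m + 2) j
      = (1 - q ^ (m + 1)) * ∑ j ∈ range N, (-1) ^ j * qb q m j := by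
  obtain ⟨N, rfl⟩ : ∃ K, N = K + 1 := ⟨N - 1, by omega⟩
  have e1 : ∑ j ∈ range (N + 1), (-1) ^ j * qb q (m + 2) j =
      1 + ∑ j ∈ range N, (-1) ^ (j + 1) * qb q (m + 1) j
       + ∑ j ∈ range N, (-1) ^ (j + 1) * (q ^ (j + 1) * qb q (m + 1) (j + 1)) := by
    rw [sum_range_succ', qb_zero, add_assoc, ← sum_add_distrib, add_comm]
    simp only [qb_succ q (m + 1), mul_add, pow_zero, mul_one]
  have e2 : ∑ j ∈ range N, (-1) ^ (j + 1) * (q ^ (j + 1) * qb q (m + 1) (j + 1)) =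
      ∑ j ∈ range N, (-1) ^ (j + 1) * qb q (m + 1) (j + 1)
      + (1 - q ^ (m + 1)) * ∑ j ∈ range N, (-1) ^ j * qb q m j := by
    rw [mul_sum, ← sum_add_distrib]
    refine sum_congr rfl fun j _ => ?_
    have := qb_abs q m j
    linear_combination (-1) ^ j * this
  have e3 : ∑ j ∈ range N, (-1) ^ (j + 1) * qb q (m + 1) j
      = - ∑ j ∈ range (N + 1), (-1) ^ j * qb q (m + 1) j := by
    rw [sum_range_succ, qb_gt q (m + 1) N (by omega), mul_zero, add_zero, ← sum_neg_distrib]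
    exact sum_congr rfl fun j _ => by ring
  have e4 : ∑ j ∈ range (N + 1), (-1) ^ j * qb q m j = ∑ j ∈ range N, (-1) ^ j * qb q m j := by
    rw [sum_range_succ, qb_gt q m N (by omega), mul_zero, add_zero]
  rw [e1, e2, e3, e4, sum_range_succ' _ N, qb_zero]
  simp

lemma qb_alt_even (q : ℂ) (k N : ℕ) (h : 2 * k < N) :
    ∑ j ∈ range N, (-1) ^ j * qb q (2 * k) j = ∏ i ∈ range k, (1 - q ^ (2 * i + 1)) := by
  induction k with
  | zero =>
    obtain ⟨N, rfl⟩ : ∃ K, N = K + 1 := ⟨N - 1, by omega⟩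
    rw [sum_range_succ']
    simp [qb]
  | succ k ih =>
    rw [show 2 * (k + 1) = 2 * k + 2 by ring, qb_alt q N _ (by omega), ih (by omega),
      prod_range_succ, mul_comm]

lemma qb_root (w : ℂ) (k : ℕ) (hw : IsPrimitiveRoot w (2 * k + 1)) : ∀ j, j ≤ 2 * k →
    (-1) ^ j * qb ((w ^ 2)⁻¹) (2 * k) j = w ^ (j * (j + 1)) := by
  have hw0 : w ≠ 0 := hw.ne_zero (by omega)
  intro j
  induction j with
  | zero => intro _; simp [qb_zero]
  | succ j ih =>
    intro hj
    have h1 := qb_abs ((w ^ 2)⁻¹) (2 * k) j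
    have h2 : ((w ^ 2)⁻¹) ^ (2 * k + 1) = 1 := by
      rw [inv_pow, ← pow_mul, mul_comm, pow_mul, hw.pow_eq_one]; simp
    have h3 : 1 - ((w ^ 2)⁻¹) ^ (j + 1) ≠ 0 := by
      intro h
      have h' : w ^ (2 * (j + 1)) = 1 := by
        rw [pow_mul, ← inv_inj, ← inv_pow, inv_one]; linear_combination -h
      have := (hw.dvd_of_pow_eq_one _ h')
      have h5 := (Nat.Coprime.dvd_of_dvd_mul_left (by simp) this)
      have := Nat.le_of_dvd (by omega) h5
      omega
    rw [h2, sub_self, zero_mul] at h1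
    have h4 := (mul_eq_zero.1 h1).resolve_left h3
    rw [qb_succ] at h4
    have h5 := ih (by omega)
    have h6 : w ^ (2 * (j + 1)) * ((w ^ 2)⁻¹) ^ (j + 1) = 1 := by
      rw [inv_pow, ← pow_mul]; exact mul_inv_cancel₀ (pow_ne_zero _ hw0)
    have h7 : w ^ ((j + 1) * (j + 1 + 1)) = w ^ (2 * (j + 1)) * w ^ (j * (j + 1)) := by ring
    rw [h7, ← h5]
    linear_combination (-1) ^ (j + 1) * w ^ (2 * (j + 1)) * h4
      - (-1) ^ (j + 1) * qb ((w ^ 2)⁻¹) (2 * k) (j + 1) * h6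

lemma gauss_prod (w : ℂ) (k : ℕ) (hw : IsPrimitiveRoot w (2 * k + 1)) :
    ∑ j ∈ range (2 * k + 1), w ^ (j * (j + 1)) =
      ∏ i ∈ range k, (1 - ((w ^ 2)⁻¹) ^ (2 * i + 1)) := by
  rw [← qb_alt_even _ k (2 * k + 1) (by omega)]
  exact sum_congr rfl fun j hj => (qb_root w k hw j (by simp at hj; omega)).symm

lemma gauss_prod' (w : ℂ) (k : ℕ) (hw : IsPrimitiveRoot w (2 * k + 1)) :
    w ^ (k ^ 2) * ∑ j ∈ range (2 * k + 1), w ^ (j * (j + 1)) =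
      ∏ i ∈ range k, (w ^ (2 * i + 1) - (w ^ (2 * i + 1))⁻¹) := by
  have hw0 : w ≠ 0 := hw.ne_zero (by omega)
  rw [gauss_prod w k hw]
  have : w ^ (k ^ 2) = ∏ i ∈ range k, w ^ (2 * i + 1) := by
    clear hw
    induction k with
    | zero => simp
    | succ k ih => rw [prod_range_succ, ← ih]; ring
  rw [this, ← prod_mul_distrib]
  refine prod_congr rfl fun i _ => ?_
  have := pow_ne_zero (2 * i + 1) hw0
  rw [inv_pow, ← pow_mul, mul_comm 2, pow_mul]
  field_simp
  ring

/-- complex quadratic character -/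
noncomputable def cq (p : ℕ) [Fact p.Prime] : MulChar (ZMod p) ℂ :=
  (quadraticChar (ZMod p)).ringHomComp (Int.castRingHom ℂ)

lemma cq_apply (p : ℕ) [Fact p.Prime] (x : ZMod p) : cq p x = ((quadraticChar (ZMod p) x : ℤ) : ℂ) := rfl

lemma ep_eq (p : ℕ) [Fact p.Prime] (a : ZMod p) : ep p a = ZMod.stdAddChar a := by
  have := ZMod.stdAddChar_coe (N := p) (a.val : ℤ)
  rw [ep]
  simpa using this.symm

lemma sum_range_zmod (p : ℕ) [Fact p.Prime] (f : ZMod p → ℂ) :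
    ∑ x, f x = ∑ j ∈ range p, f (j : ZMod p) := by
  symm
  refine sum_bij (fun j _ => (j : ZMod p)) (fun _ _ => mem_univ _) ?_ ?_ (fun _ _ => rfl)
  · intro a ha b hb h
    rw [ZMod.natCast_eq_natCast_iff'] at h
    rwa [Nat.mod_eq_of_lt (mem_range.1 ha), Nat.mod_eq_of_lt (mem_range.1 hb)] at h
  · intro b _
    exact ⟨b.val, mem_range.2 (ZMod.val_lt b), by simp⟩

lemma ringChar_ne (p : ℕ) [Fact p.Prime] (hodd : Odd p) : ringChar (ZMod p) ≠ 2 := by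
  rw [ZMod.ringChar_zmod_n]; rintro rfl; exact absurd hodd (by decide)

lemma gauss_eq_sq (p : ℕ) [Fact p.Prime] (hodd : Odd p) :
    gaussSum (cq p) ZMod.stdAddChar = ∑ x : ZMod p, ZMod.stdAddChar (x ^ 2) := by
  have h1 : ∑ x : ZMod p, ZMod.stdAddChar (x ^ 2) =
      ∑ t : ZMod p, (cq p t + 1) * ZMod.stdAddChar t := by
    rw [← sum_fiberwise univ (fun x : ZMod p => x ^ 2)]
    refine sum_congr rfl fun t _ => ?_
    rw [sum_congr rfl (g := fun _ => ZMod.stdAddChar t)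
      (fun x hx => by rw [(mem_filter.1 hx).2]), sum_const, nsmul_eq_mul]
    congr 1
    have := quadraticChar_card_sqrts (ringChar_ne p hodd) t
    rw [cq_apply]
    have h2 : (univ.filter (fun x : ZMod p => x ^ 2 = t)) = {x : ZMod p | x ^ 2 = t}.toFinset := by
      ext; simp
    rw [h2]
    exact_mod_cast this
  rw [h1]
  simp only [add_mul, one_mul, sum_add_distrib]
  have : ∑ t : ZMod p, ZMod.stdAddChar t = (0 : ℂ) := by
    rw [AddChar.sum_eq_zero_iff_ne_zero]
    intro h
    have h2 := ZMod.isPrimitive_stdAddChar p (a := 1) one_ne_zero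
    apply h2
    rw [h]; ext; simp
  rw [this, add_zero]; rfl

lemma gauss_eq_prod (p k : ℕ) [Fact p.Prime] (hk : p = 2 * k + 1) :
    gaussSum (cq p) ZMod.stdAddChar = Complex.I ^ k *
      ((∏ i ∈ range k, (2 * Real.sin (2 * Real.pi * (2 * i + 1) / p)) : ℝ) : ℂ) := by
  have hodd : Odd p := ⟨k, hk⟩
  have hp0 : p ≠ 0 := by omega
  set w : ℂ := Complex.exp (2 * Real.pi * Complex.I / p) with hw
  have hprim : IsPrimitiveRoot w (2 * k + 1) := hk ▸ Complex.isPrimitiveRoot_exp p hp0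
  have hψ : ∀ j : ℕ, ZMod.stdAddChar (j : ZMod p) = w ^ j := by
    intro j
    have := ZMod.stdAddChar_coe (N := p) (j : ℤ)
    rw [Int.cast_natCast] at this
    rw [this, hw, ← Complex.exp_nat_mul]
    congr 1
    push_cast
    ring
  have hz : (2 * k + 1 : ZMod p) = 0 := by
    have : ((2 * k + 1 : ℕ) : ZMod p) = 0 := by
      rw [ZMod.natCast_eq_zero_iff]; exact hk.dvd
    push_cast at this
    exact this
  rw [gauss_eq_sq p hodd, ← Equiv.sum_comp (Equiv.addRight ((k : ZMod p) + 1)), sum_range_zmod]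
  have h1 : ∀ j : ℕ, ZMod.stdAddChar ((Equiv.addRight ((k : ZMod p) + 1)) (j : ZMod p) ^ 2)
      = w ^ (k ^ 2) * w ^ (j * (j + 1)) := by
    intro j
    rw [← pow_add, ← hψ]
    congr 1
    simp only [Equiv.coe_addRight]
    push_cast
    linear_combination (1 + j : ZMod p) * hz
  simp only [h1]
  rw [← mul_sum]
  have h2 := gauss_prod' w k hprim
  rw [← hk] at h2
  rw [h2]
  push_cast
  rw [← card_range k, ← prod_const, card_range, ← prod_mul_distrib]
  refine prod_congr rfl fun i _ => ?_
  have h3 : w ^ (2 * i + 1) = Complex.exp ((2 * Real.pi * (2 * i + 1) / p : ℂ) * Complex.I) := by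
    rw [hw, ← Complex.exp_nat_mul]
    congr 1
    push_cast
    ring
  rw [h3, ← Complex.exp_neg, Complex.sin, neg_mul]
  ring_nf
  simp
  ring

lemma sin_prod_pos (p k : ℕ) (hk : p = 2 * k + 1) :
    0 < (-1) ^ (k / 2) * ∏ i ∈ range k, (2 * Real.sin (2 * Real.pi * (2 * i + 1) / p)) := by
  obtain ⟨a, b, hab, hb, ha⟩ : ∃ a b, k = a + b ∧ k / 2 = b ∧ b ≤ a ∧ a ≤ b + 1 :=
    ⟨k - k / 2, k / 2, by omega, rfl, by omega⟩
  have hpi := Real.pi_pos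
  have hp : (p : ℝ) = 2 * (a + b) + 1 := by rw [hk, hab]; push_cast; ring
  have hp0 : (0 : ℝ) < p := by rw [hp]; positivity
  rw [hb, hab, prod_range_add]
  have h1 : 0 < ∏ i ∈ range a, (2 * Real.sin (2 * Real.pi * (2 * i + 1) / p)) := by
    refine prod_pos fun i hi => mul_pos two_pos (Real.sin_pos_of_pos_of_lt_pi (by positivity) ?_)
    rw [div_lt_iff₀ hp0]
    have : (4 * i + 2 + 1 : ℝ) ≤ p := by
      have := mem_range.1 hi
      rw [hk]
      exact_mod_cast (by omega : 4 * i + 2 + 1 ≤ 2 * k + 1)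
    nlinarith
  have h2 : 0 < (-1) ^ b * ∏ i ∈ range b, (2 * Real.sin (2 * Real.pi * (2 * (a + i : ℕ) + 1) / p)) := by
    conv_rhs => rw [← card_range b, ← prod_const, card_range, ← prod_mul_distrib]
    refine prod_pos fun i hi => ?_
    have h4 := mem_range.1 hi
    have : (4 * (a + i : ℕ) + 2 : ℝ) ≥ p + 1 := by
      rw [hk]
      exact_mod_cast (by omega : 4 * (a + i) + 2 ≥ 2 * k + 1 + 1)
    have h5 : ((a + i : ℕ) : ℝ) * 2 + 1 + 1 ≤ p := by
      rw [hk]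
      exact_mod_cast (by omega : (a + i) * 2 + 1 + 1 ≤ 2 * k + 1)
    have h3 : 0 < Real.sin (2 * Real.pi * (2 * (a + i : ℕ) + 1) / p - Real.pi) := by
      refine Real.sin_pos_of_pos_of_lt_pi ?_ ?_
      · rw [sub_pos, lt_div_iff₀ hp0]
        nlinarith
      · rw [sub_lt_iff_lt_add, div_lt_iff₀ hp0]
        nlinarith
    rw [Real.sin_sub_pi] at h3
    linarith
  have := mul_pos h1 h2
  linarith

lemma cq_neg_one (p : ℕ) [Fact p.Prime] (hodd : Odd p) :
    cq p (-1) = if p % 4 = 1 then 1 else -1 := by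
  rw [cq_apply, quadraticChar_neg_one (ringChar_ne p hodd), ZMod.card, ZMod.χ₄_nat_eq_if_mod_four]
  have : p % 2 ≠ 0 := by rw [Nat.odd_iff] at hodd; omega
  rw [if_neg this]
  split_ifs <;> simp

lemma cq_quad (p : ℕ) [Fact p.Prime] : (cq p).IsQuadratic :=
  (quadraticChar_isQuadratic (ZMod p)).comp _

lemma cq_ne_one (p : ℕ) [Fact p.Prime] (hodd : Odd p) : cq p ≠ 1 := by
  obtain ⟨a, ha⟩ := quadraticChar_exists_neg_one (ringChar_ne p hodd)
  intro h
  have h1 : cq p a = -1 := by rw [cq_apply, ha]; simp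
  rw [h] at h1
  by_cases h0 : IsUnit a
  · rw [MulChar.one_apply h0] at h1; norm_num at h1
  · rw [MulChar.map_nonunit _ h0] at h1; norm_num at h1

lemma gauss_eval (p : ℕ) [Fact p.Prime] (hodd : Odd p) :
    gaussSum (cq p) ZMod.stdAddChar = (if p % 4 = 1 then 1 else Complex.I) * Real.sqrt p := by
  obtain ⟨k, hk⟩ := hodd
  have hodd : Odd p := ⟨k, hk⟩
  have hsq := gaussSum_sq (cq_ne_one p hodd) (cq_quad p) (ZMod.isPrimitive_stdAddChar p)
  have hpos := sin_prod_pos p k hk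
  rw [cq_neg_one p hodd, ZMod.card] at hsq
  rw [gauss_eq_prod p k hk] at hsq ⊢
  generalize ∏ i ∈ range k, (2 * Real.sin (2 * Real.pi * (2 * i + 1) / p)) = R at *
  have hI : Complex.I ^ k = (if p % 4 = 1 then 1 else Complex.I) * (-1) ^ (k / 2) := by
    rw [← Complex.I_sq, ← pow_mul]
    split_ifs with h
    · rw [one_mul]; congr 1; omega
    · rw [← pow_succ']; congr 1; omega
  have hR : ((-1) ^ (k / 2) * R) ^ 2 = p := by
    rw [hI] at hsq
    have : (((-1) ^ (k / 2) * R : ℝ) : ℂ) ^ 2 = p := by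
      push_cast
      split_ifs at hsq with h
      · linear_combination hsq
      · linear_combination - hsq + ((-1) ^ (k / 2) * (R : ℂ)) ^ 2 * Complex.I_sq
    exact_mod_cast this
  have : Real.sqrt p = (-1) ^ (k / 2) * R := by
    rw [← hR, Real.sqrt_sq hpos.le]
  rw [this, hI]
  push_cast
  ring

lemma salie_eq (p : ℕ) [Fact p.Prime] (m n : ZMod p) :
    salieSum p m n = ∑ x : (ZMod p)ˣ, cq p x * ZMod.stdAddChar (m * (x : ZMod p) + n * (x : ZMod p)⁻¹) := by
  rw [salieSum]
  refine sum_congr rfl fun x _ => ?_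
  rw [ep_eq, legendreSym, cq_apply, Int.cast_natCast, ZMod.natCast_zmod_val,
    Units.val_inv_eq_inv_val]

lemma cq_sq (p : ℕ) [Fact p.Prime] {x : ZMod p} (hx : x ≠ 0) : cq p (x ^ 2) = 1 := by
  rw [cq_apply, quadraticChar_sq_one' hx]; simp

lemma cq_inv (p : ℕ) [Fact p.Prime] (x : ZMod p) : cq p x⁻¹ = cq p x := by
  by_cases hx : x = 0
  · simp [hx]
  · have : x⁻¹ = x * (x⁻¹) ^ 2 := by field_simp
    rw [this, map_mul, cq_sq p (inv_ne_zero hx), mul_one]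

lemma salie_neg (p : ℕ) [Fact p.Prime] (m n : ZMod p) (hm : m ≠ 0) (hn : n ≠ 0)
    (h : cq p (m * n) = -1) : salieSum p m n = 0 := by
  have key : salieSum p m n = - salieSum p m n := by
    rw [salie_eq]
    conv_lhs => rw [← Equiv.sum_comp ((Equiv.inv (ZMod p)ˣ).trans
      (Equiv.mulLeft (Units.mk0 (n * m⁻¹) (mul_ne_zero hn (inv_ne_zero hm)))))]
    rw [← sum_neg_distrib]
    refine sum_congr rfl fun x _ => ?_
    have hx : (x : ZMod p) ≠ 0 := x.ne_zero
    simp only [Equiv.trans_apply, Equiv.inv_apply, Equiv.coe_mulLeft, Units.val_mul, Units.val_mk0,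
      Units.val_inv_eq_inv_val]
    have e1 : cq p (n * m⁻¹ * (x : ZMod p)⁻¹) = - cq p x := by
      rw [map_mul, map_mul, cq_inv, cq_inv, mul_comm (cq p n), ← map_mul, h]; ring
    have e2 : m * (n * m⁻¹ * (x : ZMod p)⁻¹) + n * (n * m⁻¹ * (x : ZMod p)⁻¹)⁻¹
        = m * x + n * (x : ZMod p)⁻¹ := by field_simp; ring
    rw [e1, e2]; ring
  linear_combination key / 2

lemma two_ne (p : ℕ) [Fact p.Prime] (hodd : Odd p) : (2 : ZMod p) ≠ 0 :=
  Ring.two_ne_zero (ringChar_ne p hodd)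

lemma fiber (p : ℕ) [Fact p.Prime] (hodd : Odd p) (t : ZMod p) :
    ∑ x ∈ univ.filter (fun y : (ZMod p)ˣ => (y : ZMod p) + (y : ZMod p)⁻¹ = t), cq p x = cq p (t + 2) + cq p (t - 2) := by
  have h2 := two_ne p hodd
  by_cases hr : ∃ x : (ZMod p)ˣ, (x : ZMod p) + (x : ZMod p)⁻¹ = t
  · obtain ⟨x, hx⟩ := hr
    have hx0 : (x : ZMod p) ≠ 0 := x.ne_zero
    have hf : univ.filter (fun y : (ZMod p)ˣ => (y : ZMod p) + (y : ZMod p)⁻¹ = t) = {x, x⁻¹} := by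
      ext y
      have hy0 : (y : ZMod p) ≠ 0 := y.ne_zero
      simp only [mem_filter, mem_univ, true_and, mem_insert, mem_singleton, Units.ext_iff,
        Units.val_inv_eq_inv_val]
      constructor
      · intro hy
        have : ((y : ZMod p) - x) * (y - (x : ZMod p)⁻¹) = 0 := by
          have e : (y : ZMod p) + (y : ZMod p)⁻¹ = x + (x : ZMod p)⁻¹ := by rw [hy, hx]
          have e1 : (x : ZMod p) * (x : ZMod p)⁻¹ = 1 := mul_inv_cancel₀ hx0
          have e2 : (y : ZMod p) * (y : ZMod p)⁻¹ = 1 := mul_inv_cancel₀ hy0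
          linear_combination (y : ZMod p) * e + e1 - e2
        rcases mul_eq_zero.1 this with h | h
        · left; exact sub_eq_zero.1 h
        · right; exact sub_eq_zero.1 h
      · rintro (h | h)
        · rw [h, hx]
        · rw [h, inv_inv, add_comm, hx]
    rw [hf]
    have p1 : (x : ZMod p) ≠ -1 → cq p (t + 2) = cq p x := by
      intro h
      have h' : (x : ZMod p) + 1 ≠ 0 := fun h'' => h (by linear_combination h'')
      have : t + 2 = (x : ZMod p)⁻¹ * (x + 1) ^ 2 := by rw [← hx]; field_simp; ring
      rw [this, map_mul, cq_sq p h', mul_one, cq_inv]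
    have p2 : (x : ZMod p) ≠ 1 → cq p (t - 2) = cq p x := by
      intro h
      have h' : (x : ZMod p) - 1 ≠ 0 := fun h'' => h (by linear_combination h'')
      have : t - 2 = (x : ZMod p)⁻¹ * (x - 1) ^ 2 := by rw [← hx]; field_simp; ring
      rw [this, map_mul, cq_sq p h', mul_one, cq_inv]
    have h11 : (1 : ZMod p) ≠ -1 := fun h => h2 (by linear_combination h)
    by_cases c1 : (x : ZMod p) = 1
    · have hx1 : x = 1 := Units.ext c1
      have : t - 2 = 0 := by rw [← hx, c1]; norm_num
      rw [p1 (by rw [c1]; exact h11), this, hx1]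
      simp [MulChar.map_zero (cq p)]
    by_cases c2 : (x : ZMod p) = -1
    · have hx1 : x = -1 := Units.ext (by simpa using c2)
      have : t + 2 = 0 := by rw [← hx, c2]; norm_num
      rw [p2 c1, this, hx1]
      simp [MulChar.map_zero (cq p)]
    have hne : x ≠ x⁻¹ := by
      intro h
      have h' := congrArg (fun u : (ZMod p)ˣ => (u : ZMod p)) h
      simp only [Units.val_inv_eq_inv_val] at h'
      have : ((x : ZMod p) - 1) * (x + 1) = 0 := by
        have e1 : (x : ZMod p) * (x : ZMod p)⁻¹ = 1 := mul_inv_cancel₀ hx0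
        linear_combination (x : ZMod p) * h' + e1
      rcases mul_eq_zero.1 this with h | h
      · exact c1 (sub_eq_zero.1 h)
      · exact c2 (eq_neg_of_add_eq_zero_left h)
    rw [sum_pair hne, p1 c2, p2 c1, Units.val_inv_eq_inv_val, cq_inv]
  · have hf : univ.filter (fun y : (ZMod p)ˣ => (y : ZMod p) + (y : ZMod p)⁻¹ = t) = ∅ := by
      rw [filter_eq_empty_iff]
      intro x _ hx
      exact hr ⟨x, hx⟩
    rw [hf, sum_empty]
    have hns : ¬ IsSquare ((t + 2) * (t - 2)) := by
      rintro ⟨s, hs⟩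
      have hq : ((t + s) / 2) ^ 2 - t * ((t + s) / 2) + 1 = 0 := by
        field_simp
        linear_combination -hs
      have h0 : (t + s) / 2 ≠ 0 := by
        intro h0
        rw [h0] at hq
        simp at hq
      refine hr ⟨Units.mk0 _ h0, ?_⟩
      rw [Units.val_mk0]
      generalize (t + s) / 2 = z at *
      field_simp
      linear_combination hq
    have hc : cq p (t + 2) * cq p (t - 2) = -1 := by
      rw [← map_mul, cq_apply, quadraticChar_neg_one_iff_not_isSquare.2 hns]; simp
    rcases cq_quad p (t + 2) with h | h | h <;> rw [h] at hc ⊢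
    · simp at hc
    · linear_combination -hc
    · linear_combination hc

lemma gauss_shift (p : ℕ) [Fact p.Prime] (a b : ZMod p) (ha : a ≠ 0) :
    ∑ t : ZMod p, cq p (t + b) * ZMod.stdAddChar (a * t) =
      cq p a * gaussSum (cq p) ZMod.stdAddChar * ZMod.stdAddChar (-(a * b)) := by
  rw [← Equiv.sum_comp ((Equiv.mulLeft₀ a⁻¹ (inv_ne_zero ha)).trans (Equiv.subRight b)), gaussSum, mul_sum,
    sum_mul]
  refine sum_congr rfl fun x _ => ?_
  simp only [Equiv.trans_apply, Equiv.subRight_apply, Equiv.mulLeft₀_apply, sub_add_cancel]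
  rw [map_mul, cq_inv, mul_sub, mul_inv_cancel_left₀ ha, sub_eq_add_neg, AddChar.map_add_eq_mul]
  ring

lemma salie_sq (p : ℕ) [Fact p.Prime] (hodd : Odd p) (m n a : ZMod p) (ha : a ≠ 0)
    (hn : n ≠ 0) (h : m * n = a ^ 2) :
    salieSum p m n = cq p n * gaussSum (cq p) ZMod.stdAddChar *
      (ZMod.stdAddChar (2 * a) + ZMod.stdAddChar (2 * (-a))) := by
  have e1 : salieSum p m n = cq p n * cq p a * ∑ x : (ZMod p)ˣ,
      cq p x * ZMod.stdAddChar (a * ((x : ZMod p) + (x : ZMod p)⁻¹)) := by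
    rw [salie_eq, ← Equiv.sum_comp (Equiv.mulLeft (Units.mk0 (n * a⁻¹) (mul_ne_zero hn (inv_ne_zero ha)))),
      mul_sum]
    refine sum_congr rfl fun x _ => ?_
    have hx : (x : ZMod p) ≠ 0 := x.ne_zero
    simp only [Equiv.coe_mulLeft, Units.val_mul, Units.val_mk0]
    have e2 : m * (n * a⁻¹ * (x : ZMod p)) + n * (n * a⁻¹ * (x : ZMod p))⁻¹
        = a * (x + (x : ZMod p)⁻¹) := by
      field_simp
      linear_combination (x : ZMod p) ^ 2 * h
    rw [e2, map_mul, map_mul, cq_inv]; ring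
  have e3 : ∑ x : (ZMod p)ˣ, cq p x * ZMod.stdAddChar (a * ((x : ZMod p) + (x : ZMod p)⁻¹))
      = ∑ t : ZMod p, (cq p (t + 2) + cq p (t + -2)) * ZMod.stdAddChar (a * t) := by
    rw [← sum_fiberwise univ (fun x : (ZMod p)ˣ => (x : ZMod p) + (x : ZMod p)⁻¹)]
    refine sum_congr rfl fun t _ => ?_
    rw [← sub_eq_add_neg, ← fiber p hodd, sum_mul]
    exact sum_congr rfl fun x hx => by rw [(mem_filter.1 hx).2]
  have e4 : cq p a * cq p a = 1 := by rw [← map_mul, ← pow_two, cq_sq p ha]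
  rw [e1, e3]
  simp only [add_mul, sum_add_distrib]
  rw [gauss_shift p a 2 ha, gauss_shift p a (-2) ha, show -(a * 2) = 2 * -a by ring,
    show -(a * -2) = 2 * a by ring]
  linear_combination cq p n * gaussSum (cq p) ZMod.stdAddChar *
      (ZMod.stdAddChar (2 * a) + ZMod.stdAddChar (2 * (-a))) * e4

/-- Closed form evaluation of the Salié sum: for `p ∤ mn`, `S(m,n;p)` vanishes if
`(mn|p) = −1`, and equals `(n|p) ε_p √p ∑_{x² = mn} e_p(2x)` if `(mn|p) = 1`. -/
theorem stmt7 (p : ℕ) [Fact p.Prime] (hodd : Odd p) (m n : ℤ) (h : ¬ (p : ℤ) ∣ m * n) :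
    (legendreSym p (m * n) = -1 → salieSum p ((m : ZMod p)) ((n : ZMod p)) = 0) ∧
    (legendreSym p (m * n) = 1 →
      salieSum p ((m : ZMod p)) ((n : ZMod p))
        = (legendreSym p n : ℂ) * (if p % 4 = 1 then 1 else Complex.I) * Real.sqrt p *
          ∑ x ∈ Finset.univ.filter (fun x : ZMod p => x^2 = ((m * n : ℤ) : ZMod p)),
            ep p (2 * x)) := by
  have hmn : ((m : ZMod p)) * (n : ZMod p) ≠ 0 := by
    intro h0
    apply h
    rw [← ZMod.intCast_zmod_eq_zero_iff_dvd]
    push_cast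
    exact h0
  have hm := left_ne_zero_of_mul hmn
  have hn := right_ne_zero_of_mul hmn
  constructor
  · intro hl
    refine salie_neg p _ _ hm hn ?_
    rw [legendreSym] at hl
    push_cast at hl
    rw [cq_apply, hl]
    simp
  · intro hl
    rw [legendreSym] at hl
    push_cast at hl
    obtain ⟨a, ha⟩ := (quadraticChar_one_iff_isSquare hmn).1 hl
    rw [← pow_two] at ha
    have ha0 : a ≠ 0 := by rintro rfl; exact hmn (by simpa using ha)
    have hne : a ≠ -a := fun h => mul_ne_zero (two_ne p hodd) ha0 (by linear_combination h)
    have hf : univ.filter (fun x : ZMod p => x ^ 2 = ((m * n : ℤ) : ZMod p)) = {a, -a} := by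
      ext x
      push_cast
      simp [ha, sq_eq_sq_iff_eq_or_eq_neg]
    rw [hf, sum_pair hne, ep_eq, ep_eq, salie_sq p hodd _ _ a ha0 hn ha, gauss_eval p hodd,
      legendreSym, ← cq_apply]
    ring
end

section
/- For every ε > 0 there exists a constant C_ε > 0 with the following property. Let p ≥ 2 be a prime, let N ≥ 1 be a real number, let δ₂, δ₃, δ₅ ∈ (0, 1), and let α, β ∈ ℝ. Assume that for every integer h with 1 ≤ h ≤ p^{δ₅} there exist coprime integers a_h, b_h with p^{δ₂} ≤ b_h ≤ p^{δ₃} and |h α − a_h / b_h| ≤ 1/b_h². Then #{ n ∈ ℤ : 1 ≤ n ≤ N and ‖α n² + β‖ ≤ 8N/p } ≤ C_ε ( N²/p + N p^{−δ₅} + N^{1+ε} p^{−δ₂/2 + ε} + N^{1/2+ε} p^{ε} + p^{δ₃/2 + ε} ). -/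
open Finset

/-- `‖x‖`: the distance from the real number `x` to the nearest integer. -/
noncomputable def nint (x : ℝ) : ℝ := |x - (round x : ℝ)|

namespace WeylAux

noncomputable def e (x : ℝ) : ℂ := Complex.exp ((2 * Real.pi * x : ℝ) * Complex.I)

lemma e_add (x y : ℝ) : e (x + y) = e x * e y := by
  unfold e; rw [← Complex.exp_add]; congr 1; push_cast; ring

lemma norm_e (x : ℝ) : ‖e x‖ = 1 := by
  unfold e; exact Complex.norm_exp_ofReal_mul_I _

lemma conj_e (x : ℝ) : (starRingEnd ℂ) (e x) = e (-x) := by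
  unfold e; rw [← Complex.exp_conj]; congr 1
  rw [map_mul, Complex.conj_ofReal, Complex.conj_I]; push_cast; ring

lemma e_nat_mul (n : ℕ) (x : ℝ) : e (n * x) = e x ^ n := by
  unfold e; rw [← Complex.exp_nat_mul]; congr 1; push_cast; ring

lemma e_int (n : ℤ) : e n = 1 := by
  unfold e; rw [Complex.exp_eq_one_iff]; exact ⟨n, by push_cast; ring⟩

lemma e_re (x : ℝ) : (e x).re = Real.cos (2 * Real.pi * x) := by
  unfold e; exact Complex.exp_ofReal_mul_I_re _

lemma vdc (w : ℕ → ℂ) (H : ℕ) :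
    ‖∑ j ∈ range H, w j‖ ^ 2 ≤
      2 * (∑ k ∈ range H, ∑ j ∈ range (H - k), w (k + j) * (starRingEnd ℂ) (w j)).re := by
  rw [← Finset.sum_range_diag_flip H (fun k j => w (k + j) * (starRingEnd ℂ) (w j))]
  induction H with
  | zero => simp
  | succ n ih =>
    rw [Finset.sum_range_succ, Finset.sum_range_succ (n := n), Complex.add_re]
    have h1 : ∑ k ∈ range (n + 1), w (k + (n - k)) * (starRingEnd ℂ) (w (n - k))
        = w n * (starRingEnd ℂ) (∑ j ∈ range (n+1), w j) := by
      rw [map_sum, mul_sum, ← Finset.sum_range_reflect]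
      apply sum_congr rfl
      intro k hk
      rw [mem_range] at hk
      have : n + 1 - 1 - k = n - k := by omega
      rw [this]
      have h2 : n - k + (n - (n - k)) = n := by omega
      have h3 : n - (n - k) = k := by omega
      rw [h2, h3]
    rw [h1, sum_range_succ]
    have h4 : ‖∑ x ∈ range n, w x + w n‖ ^ 2 = ‖∑ x ∈ range n, w x‖ ^ 2 +
        2 * (w n * (starRingEnd ℂ) (∑ x ∈ range n, w x)).re + ‖w n‖ ^ 2 := by
      rw [← Complex.normSq_eq_norm_sq, ← Complex.normSq_eq_norm_sq, ← Complex.normSq_eq_norm_sq]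
      simp only [Complex.normSq_apply, Complex.add_re, Complex.add_im, Complex.mul_re,
        Complex.conj_re, Complex.conj_im]
      ring
    rw [h4, map_add, mul_add, mul_add, Complex.add_re, Complex.mul_conj (w n), Complex.normSq_eq_norm_sq]
    have h5 : (((‖w n‖ ^ 2 : ℝ) : ℂ)).re = ‖w n‖ ^ 2 := Complex.ofReal_re _
    rw [h5]
    nlinarith [sq_nonneg ‖w n‖]

lemma norm_e_sub_one (x : ℝ) : 4 * nint x ≤ ‖e x - 1‖ := by
  have h0 : e x = e (x - round x) := by
    have : x = (x - round x) + (round x : ℤ) := by ring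
    conv_lhs => rw [this, e_add, e_int, mul_one]
  rw [h0]
  unfold nint
  have hy := abs_sub_round x
  generalize x - round x = y at *
  unfold e
  rw [mul_comm _ Complex.I, Complex.norm_exp_I_mul_ofReal_sub_one]
  have h1 : 2 * Real.pi * y / 2 = Real.pi * y := by ring
  rw [h1, norm_mul, Real.norm_eq_abs, Real.norm_eq_abs]
  have h2 := Real.mul_abs_le_abs_sin (x := Real.pi * y) (by
    rw [abs_mul, abs_of_pos Real.pi_pos]; nlinarith [Real.pi_pos])
  rw [abs_mul, abs_of_pos Real.pi_pos] at h2
  have h3 : 2 / Real.pi * (Real.pi * |y|) = 2 * |y| := by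
    field_simp
  rw [h3] at h2
  norm_num
  linarith

lemma geom (x : ℝ) (n : ℕ) :
    ‖∑ j ∈ range n, e (j * x)‖ * (2 * nint x) ≤ 1 := by
  have h : (∑ j ∈ range n, e (j * x)) * (e x - 1) = e x ^ n - 1 := by
    simp_rw [e_nat_mul]; exact geom_sum_mul _ _
  have h1 : ‖∑ j ∈ range n, e (j * x)‖ * ‖e x - 1‖ ≤ 2 := by
    rw [← norm_mul, h]
    refine (norm_sub_le _ _).trans ?_
    rw [norm_pow, norm_e]; norm_num
  have h2 := norm_e_sub_one x
  nlinarith [norm_nonneg (∑ j ∈ range n, e (j * x))]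

lemma norm_sum_e_le (f : ℕ → ℝ) (n : ℕ) : ‖∑ j ∈ range n, e (f j)‖ ≤ n := by
  refine (norm_sum_le _ _).trans ?_
  simp [norm_e]

/-- weight -/
noncomputable def G (M b : ℝ) (j : ℕ) : ℝ := if j = 0 then M else b / j

lemma G_nonneg {M b : ℝ} (hM : 0 ≤ M) (hb : 0 ≤ b) (j : ℕ) : 0 ≤ G M b j := by
  unfold G; split_ifs <;> positivity

lemma sum_G {M b : ℝ} (hb : 0 ≤ b) (n : ℕ) :
    ∑ j ∈ range (n + 1), G M b j ≤ M + b * (1 + Real.log n) := by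
  rw [sum_range_succ']
  have h1 : ∑ k ∈ range n, G M b (k + 1) = b * (harmonic n : ℝ) := by
    unfold G harmonic
    push_cast
    rw [mul_sum]
    apply sum_congr rfl
    intro k _
    simp [div_eq_mul_inv]
  have h2 : G M b 0 = M := by simp [G]
  rw [h1, h2]
  have := harmonic_le_one_add_log n
  nlinarith

lemma spacing {θ : ℝ} {a : ℤ} {b : ℕ} (hb : 0 < b) (hab : IsCoprime a (b : ℤ))
    (h : |θ - a / b| ≤ 1 / (b : ℝ) ^ 2) {d : ℤ} (hd0 : d ≠ 0) (hd : 2 * |d| ≤ b) (m : ℤ) :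
    1 ≤ 2 * b * |d * θ - m| := by
  have hbR : (0 : ℝ) < b := by exact_mod_cast hb
  have hne : d * a - m * b ≠ 0 := by
    intro h0
    have h1 : (b : ℤ) ∣ d * a := ⟨m, by linarith⟩
    have h2 : (b : ℤ) ∣ d := hab.symm.dvd_of_dvd_mul_right h1
    have h3 := Int.le_of_dvd (abs_pos.mpr hd0) ((dvd_abs _ _).mpr h2)
    have := abs_pos.mpr hd0
    omega
  have h1 : (1 : ℝ) ≤ |(d * a - m * b : ℝ)| := by
    exact_mod_cast Int.one_le_abs hne
  have hdR : 2 * |(d : ℝ)| ≤ b := by exact_mod_cast hd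
  have h2 : |b * (d * (θ - a / b))| ≤ 1 / 2 := by
    rw [abs_mul, abs_mul, abs_of_pos hbR]
    calc (b : ℝ) * (|(d : ℝ)| * |θ - a / b|) ≤ b * (b / 2 * (1 / (b : ℝ) ^ 2)) := by
          gcongr; linarith
      _ = 1 / 2 := by field_simp
  have h3 : (d * a - m * b : ℝ) = b * (d * θ - m) - b * (d * (θ - a / b)) := by
    field_simp; ring
  rw [h3] at h1
  have h4 := abs_sub (b * (d * θ - m)) (b * (d * (θ - a / b)))
  rw [abs_mul (b : ℝ) (d * θ - m), abs_of_pos hbR] at h4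
  linarith

lemma nint_eq (x : ℝ) : nint x = min (Int.fract x) (1 - Int.fract x) :=
  abs_sub_round_eq_min x

/-- The key sum bound. -/
lemma sum_bound {θ : ℝ} {a : ℤ} {b : ℕ} (hb : 0 < b) (hab : IsCoprime a (b : ℤ))
    (h : |θ - a / b| ≤ 1 / (b : ℝ) ^ 2) (M : ℕ) (c : ℕ → ℝ)
    (hc1 : ∀ k, c k ≤ M) (hc0 : ∀ k, 0 ≤ c k)
    (hc2 : ∀ k : ℕ, c k * (2 * nint (k * (2 * θ))) ≤ 1) :
    ∑ k ∈ range M, c k ≤ (4 * M / b + 1) * (2 * (M + b * (1 + Real.log (2 * b)))) := by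
  have hbR : (0 : ℝ) < b := by exact_mod_cast hb
  set L := b / 2 + 1 with hL
  let J : ℕ → ℕ := fun k => ⌊2 * b * Int.fract (k * (2 * θ))⌋₊
  have hJ1 : ∀ k, (J k : ℝ) ≤ 2 * b * Int.fract (k * (2 * θ)) := fun k =>
    Nat.floor_le (by have := Int.fract_nonneg (k * (2 * θ)); positivity)
  have hJ2 : ∀ k : ℕ, 2 * b * Int.fract (k * (2 * θ)) < J k + 1 := fun k => Nat.lt_floor_add_one _
  have hJ3 : ∀ k, J k < 2 * b := by
    intro k
    have h1 := hJ1 k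
    have h2 := Int.fract_lt_one (k * (2 * θ))
    have : (J k : ℝ) < 2 * b := by nlinarith
    exact_mod_cast this
  let φ : ℕ → ℕ × ℕ := fun k => (2 * k / L, J k)
  let g : ℕ → ℝ := fun j => G M b j + G M b (2 * b - 1 - j)
  have hg0 : ∀ j, 0 ≤ g j := fun j =>
    add_nonneg (G_nonneg (by positivity) hbR.le _) (G_nonneg (by positivity) hbR.le _)
  have hcg : ∀ k, c k ≤ g (J k) := by
    intro k
    have hcc := hc2 k
    rw [nint_eq] at hcc
    have hG1 := G_nonneg (M := M) (by positivity) hbR.le (J k)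
    have hG2 := G_nonneg (M := M) (by positivity) hbR.le (2 * b - 1 - J k)
    have key : ∀ (j : ℕ) (t : ℝ), c k * (2 * t) ≤ 1 → (j : ℝ) ≤ 2 * b * t → c k ≤ G M b j := by
      intro j t h1 h2
      unfold G
      split_ifs with hj
      · exact hc1 k
      · have hj' : (0 : ℝ) < j := by exact_mod_cast Nat.pos_of_ne_zero hj
        rw [le_div_iff₀ hj']
        nlinarith [hc0 k]
    rcases min_choice (Int.fract (k * (2 * θ))) (1 - Int.fract (k * (2 * θ))) with h1 | h1
    · rw [h1] at hcc
      have := key _ _ hcc (hJ1 k)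
      show c k ≤ _ + _
      linarith
    · rw [h1] at hcc
      have := key (2 * b - 1 - J k) _ hcc (by
        have e1 : ((2 * b - 1 - J k : ℕ) : ℝ) = 2 * b - 1 - J k := by
          have := hJ3 k
          rw [Nat.sub_sub, Nat.cast_sub (by omega)]
          push_cast; ring
        rw [e1]
        linarith [hJ2 k])
      show c k ≤ _ + _
      linarith
  have hinj : Set.InjOn φ (range M : Set ℕ) := by
    intro k _ k' _ hkk
    by_contra hne
    simp only [φ, Prod.mk.injEq] at hkk
    obtain ⟨q1, q2⟩ := hkk
    have hLpos : 0 < L := by omega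
    have m1 := Nat.div_add_mod (2 * k) L
    have m2 := Nat.div_add_mod (2 * k') L
    have m3 := Nat.mod_lt (2 * k) hLpos
    have m4 := Nat.mod_lt (2 * k') hLpos
    rw [q1] at m1
    have hd0 : (2 * k - 2 * k' : ℤ) ≠ 0 := by omega
    have hd : 2 * |(2 * k - 2 * k' : ℤ)| ≤ b := by
      generalize L * (2 * k' / L) = Q at *
      rcases abs_cases (2 * k - 2 * k' : ℤ) with ⟨h1, _⟩ | ⟨h1, _⟩ <;> rw [h1] <;> omega
    have hs := spacing hb hab h hd0 hd (⌊(k * (2 * θ))⌋ - ⌊k' * (2 * θ)⌋)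
    have e1 : (((2 * k - 2 * k' : ℤ) : ℝ) * θ - ((⌊(k * (2 * θ))⌋ - ⌊k' * (2 * θ)⌋ : ℤ) : ℝ))
        = Int.fract (k * (2 * θ)) - Int.fract (k' * (2 * θ)) := by
      unfold Int.fract; push_cast; ring
    rw [e1] at hs
    have a1 := hJ1 k
    have a2 := hJ2 k
    have a3 := hJ1 k'
    have a4 := hJ2 k'
    rw [q2] at a1 a2
    have : 2 * b * |Int.fract (k * (2 * θ)) - Int.fract (k' * (2 * θ))| < 1 := by
      have : (2 * b * |Int.fract (k * (2 * θ)) - Int.fract (k' * (2 * θ))| : ℝ) =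
        |2 * b * Int.fract (k * (2 * θ)) - 2 * b * Int.fract (k' * (2 * θ))| := by
        rw [← mul_sub, abs_mul, abs_of_pos (by positivity : (0 : ℝ) < 2 * b)]
      rw [this, abs_lt]
      constructor <;> linarith
    linarith
  have hmaps : (range M).image φ ⊆ range (2 * M / L + 1) ×ˢ range (2 * b) := by
    intro x hx
    rw [mem_image] at hx
    obtain ⟨k, hk, rfl⟩ := hx
    rw [mem_range] at hk
    rw [mem_product, mem_range, mem_range]
    exact ⟨Nat.lt_succ_of_le (Nat.div_le_div_right (by omega)), hJ3 k⟩
  have s1 : ∑ k ∈ range M, c k ≤ ∑ x ∈ (range M).image φ, g x.2 := by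
    rw [sum_image hinj]
    exact sum_le_sum fun k _ => hcg k
  have s2 : ∑ x ∈ (range M).image φ, g x.2 ≤
      ∑ x ∈ range (2 * M / L + 1) ×ˢ range (2 * b), g x.2 :=
    sum_le_sum_of_subset_of_nonneg hmaps fun x _ _ => hg0 _
  have s3 : ∑ x ∈ range (2 * M / L + 1) ×ˢ range (2 * b), g x.2 =
      ((2 * M / L + 1 : ℕ) : ℝ) * ∑ j ∈ range (2 * b), g j := by
    rw [sum_product]; simp
  have s4 : ∑ j ∈ range (2 * b), g j ≤ 2 * (M + b * (1 + Real.log (2 * b))) := by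
    simp only [g]
    rw [sum_add_distrib, sum_range_reflect (fun j => G (M : ℝ) b j)]
    have h1 := sum_G (M := M) hbR.le (2 * b)
    rw [sum_range_succ] at h1
    have := G_nonneg (M := M) (by positivity) hbR.le (2 * b)
    push_cast at h1
    linarith
  have s5 : ((2 * M / L + 1 : ℕ) : ℝ) ≤ 4 * M / b + 1 := by
    push_cast
    have h1 : ((2 * M / L : ℕ) : ℝ) ≤ (2 * M : ℕ) / (L : ℝ) := Nat.cast_div_le
    have h2 : (b : ℝ) ≤ 2 * L := by
      have : b ≤ 2 * L := by omega
      exact_mod_cast this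
    have h3 : ((2 * M : ℕ) : ℝ) / (L : ℝ) ≤ 4 * M / b := by
      have : (0 : ℝ) < L := by linarith
      push_cast
      rw [div_le_div_iff₀ this hbR]
      have : (0 : ℝ) ≤ M := by positivity
      nlinarith
    linarith
  have s6 : 0 ≤ ∑ j ∈ range (2 * b), g j := sum_nonneg fun j _ => hg0 j
  calc _ ≤ _ := s1.trans (s2.trans_eq s3)
    _ ≤ (4 * M / b + 1) * ∑ j ∈ range (2 * b), g j := by gcongr
    _ ≤ _ := by gcongr

lemma weyl {θ γ : ℝ} {a : ℤ} {b : ℕ} (hb : 0 < b) (hab : IsCoprime a (b : ℤ))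
    (h : |θ - a / b| ≤ 1 / (b : ℝ) ^ 2) (M : ℕ) :
    ‖∑ n ∈ range M, e (θ * (n + 1) ^ 2 + γ)‖ ^ 2 ≤
      2 * ((4 * M / b + 1) * (2 * (M + b * (1 + Real.log (2 * b))))) := by
  refine (vdc (fun n : ℕ => e (θ * (n + 1) ^ 2 + γ)) M).trans ?_
  gcongr
  refine (Complex.re_le_norm _).trans ((norm_sum_le _ _).trans ?_)
  have h1 : ∀ k ∈ range M, ‖∑ j ∈ range (M - k), e (θ * (((k + j : ℕ) : ℝ) + 1) ^ 2 + γ) *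
      (starRingEnd ℂ) (e (θ * ((j : ℝ) + 1) ^ 2 + γ))‖
      = ‖∑ j ∈ range (M - k), e (j * (k * (2 * θ)))‖ := by
    intro k _
    have : ∀ j ∈ range (M - k), e (θ * (((k + j : ℕ) : ℝ) + 1) ^ 2 + γ) *
      (starRingEnd ℂ) (e (θ * ((j : ℝ) + 1) ^ 2 + γ)) =
        e (θ * (k ^ 2 + 2 * k)) * e (j * (k * (2 * θ))) := by
      intro j _
      rw [conj_e, ← e_add, ← e_add]
      congr 1; push_cast; ring
    rw [sum_congr rfl this, ← mul_sum, norm_mul, norm_e, one_mul]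
  rw [sum_congr rfl h1]
  refine sum_bound hb hab h M (fun k => ‖∑ j ∈ range (M - k), e (j * (k * (2 * θ)))‖) ?_ ?_ ?_
  · intro k
    refine (norm_sum_e_le _ _).trans ?_
    exact_mod_cast Nat.sub_le _ _
  · intro k; positivity
  · intro k; exact geom _ _

lemma fejer_lower {x : ℝ} {H : ℕ} (hx : nint x * (6 * H) ≤ 1) :
    (H : ℝ) / 2 ≤ ‖∑ j ∈ range H, e (j * x)‖ := by
  refine le_trans ?_ (Complex.re_le_norm _)
  rw [Complex.re_sum]
  have : ∀ j ∈ range H, (1 / 2 : ℝ) ≤ (e (j * x)).re := by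
    intro j hj
    rw [mem_range] at hj
    have h0 : e (j * x) = e (j * (x - round x)) := by
      have : (j * x : ℝ) = j * (x - round x) + ((j * round x : ℤ) : ℝ) := by push_cast; ring
      rw [this, e_add, e_int, mul_one]
    rw [h0, e_re, ← Real.cos_abs, ← Real.cos_pi_div_three]
    unfold nint at hx
    have hpi := Real.pi_pos
    apply Real.cos_le_cos_of_nonneg_of_le_pi (abs_nonneg _) (by linarith)
    rw [abs_mul, abs_mul (j : ℝ), abs_of_pos (by positivity : (0 : ℝ) < 2 * Real.pi), Nat.abs_cast]
    have hjR : (j : ℝ) ≤ H := by exact_mod_cast hj.le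
    have h1 : (j : ℝ) * |x - round x| ≤ 1 / 6 := by
      nlinarith [abs_nonneg (x - round x)]
    nlinarith
  calc (H : ℝ) / 2 = ∑ j ∈ range H, (1 / 2 : ℝ) := by simp; ring
    _ ≤ _ := sum_le_sum this

lemma count_bound (x : ℕ → ℝ) (M H : ℕ) (hH : 0 < H) (Δ B : ℝ) (hΔ : Δ * (6 * H) ≤ 1)
    (hB0 : 0 ≤ B)
    (hB : ∀ k : ℕ, 1 ≤ k → k < H → ‖∑ n ∈ range M, e (k * x n)‖ ≤ B) :
    (((range M).filter (fun n => nint (x n) ≤ Δ)).card : ℝ) ≤ 8 * M / H + 8 * B := by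
  have hHR : (0 : ℝ) < H := by exact_mod_cast hH
  have h1 : (((range M).filter (fun n => nint (x n) ≤ Δ)).card : ℝ) * ((H : ℝ) / 2) ^ 2 ≤
      ∑ n ∈ range M, ‖∑ j ∈ range H, e (j * x n)‖ ^ 2 := by
    calc _ = ∑ n ∈ (range M).filter (fun n => nint (x n) ≤ Δ), ((H : ℝ) / 2) ^ 2 := by
          rw [sum_const, nsmul_eq_mul]
      _ ≤ ∑ n ∈ (range M).filter (fun n => nint (x n) ≤ Δ), ‖∑ j ∈ range H, e (j * x n)‖ ^ 2 := by
          apply sum_le_sum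
          intro n hn
          rw [mem_filter] at hn
          have := fejer_lower (x := x n) (H := H) (by nlinarith [hn.2])
          gcongr
      _ ≤ _ := sum_le_sum_of_subset_of_nonneg (filter_subset _ _) fun _ _ _ => by positivity
  have h2 : ∑ n ∈ range M, ‖∑ j ∈ range H, e (j * x n)‖ ^ 2 ≤
      2 * (∑ n ∈ range M, ∑ k ∈ range H, ((H - k : ℕ) : ℂ) * e (k * x n)).re := by
    rw [Complex.re_sum, mul_sum]
    apply sum_le_sum
    intro n _
    refine (vdc (fun j : ℕ => e (j * x n)) H).trans_eq ?_
    congr 2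
    apply sum_congr rfl
    intro k _
    have : ∀ j ∈ range (H - k), e (((k + j : ℕ) : ℝ) * x n) * (starRingEnd ℂ) (e (j * x n)) =
        e (k * x n) := by
      intro j _
      rw [conj_e, ← e_add]; congr 1; push_cast; ring
    rw [sum_congr rfl this]; simp
  have h3 : (∑ n ∈ range M, ∑ k ∈ range H, ((H - k : ℕ) : ℂ) * e (k * x n)).re ≤
      H * M + H * (H * B) := by
    rw [sum_comm]
    refine (Complex.re_le_norm _).trans ((norm_sum_le _ _).trans ?_)
    have : ∀ k ∈ range H, ‖∑ n ∈ range M, ((H - k : ℕ) : ℂ) * e (k * x n)‖ ≤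
        (if k = 0 then (H * M : ℝ) else 0) + H * B := by
      intro k hk
      rw [mem_range] at hk
      rw [← mul_sum, norm_mul, Complex.norm_natCast]
      have hk' : ((H - k : ℕ) : ℝ) ≤ H := by exact_mod_cast Nat.sub_le _ _
      split_ifs with hk0
      · have := norm_sum_e_le (fun n => k * x n) M
        have h5 : ((H - k : ℕ) : ℝ) * ‖∑ n ∈ range M, e (k * x n)‖ ≤ H * M := by gcongr
        have : 0 ≤ H * B := by positivity
        linarith
      · have := hB k (by omega) hk
        rw [zero_add]; gcongr
    refine (sum_le_sum this).trans_eq ?_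
    rw [sum_add_distrib, sum_ite_eq' (range H) 0]
    simp [hH]
  have h4 : (((range M).filter (fun n => nint (x n) ≤ Δ)).card : ℝ) * ((H : ℝ) / 2) ^ 2 ≤
      2 * (H * M + H * (H * B)) := by linarith
  have h5 : (8 * M / H + 8 * B) * ((H : ℝ) / 2) ^ 2 = 2 * (H * M + H * (H * B)) := by
    field_simp; ring
  rw [← h5] at h4
  exact le_of_mul_le_mul_right h4 (by positivity)

end WeylAux

set_option maxHeartbeats 2000000

/-- Counting bound (Weyl + Erdős–Turán): if every multiple `h α` with `1 ≤ h ≤ p^{δ₅}`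
admits a rational approximation with denominator in `[p^{δ₂}, p^{δ₃}]`, then the number
of `1 ≤ n ≤ N` with `‖α n² + β‖ ≤ 8N/p` is
`≤ C_ε (N²/p + N p^{−δ₅} + N^{1+ε} p^{−δ₂/2+ε} + N^{1/2+ε} p^ε + p^{δ₃/2+ε})`. -/
theorem stmt12 :
    ∀ ε : ℝ, 0 < ε → ∃ C : ℝ, 0 < C ∧
    ∀ p : ℕ, p.Prime →
    ∀ N : ℝ, 1 ≤ N →
    ∀ δ₂ δ₃ δ₅ : ℝ, δ₂ ∈ Set.Ioo (0 : ℝ) 1 → δ₃ ∈ Set.Ioo (0 : ℝ) 1 →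
      δ₅ ∈ Set.Ioo (0 : ℝ) 1 →
    ∀ α β : ℝ,
    (∀ h : ℤ, 1 ≤ h → (h : ℝ) ≤ (p : ℝ) ^ δ₅ →
      ∃ a b : ℤ, IsCoprime a b ∧ (p : ℝ) ^ δ₂ ≤ (b : ℝ) ∧ (b : ℝ) ≤ (p : ℝ) ^ δ₃ ∧
        |(h : ℝ) * α - (a : ℝ) / (b : ℝ)| ≤ 1 / (b : ℝ)^2) →
    (Set.ncard {n : ℤ | 1 ≤ n ∧ (n : ℝ) ≤ N ∧ nint (α * (n : ℝ)^2 + β) ≤ 8 * N / p} : ℝ)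
      ≤ C * (N^2 / p + N * (p : ℝ) ^ (-δ₅) + N ^ ((1 : ℝ) + ε) * (p : ℝ) ^ (-δ₂/2 + ε)
          + N ^ ((1 : ℝ)/2 + ε) * (p : ℝ) ^ ε + (p : ℝ) ^ (δ₃/2 + ε)) := by
  intro ε hε
  set K : ℝ := 20 * (1 + 1 / ε) with hK
  have hKpos : 0 < K := by positivity
  refine ⟨784 + 8 * √K, by positivity, ?_⟩
  intro p hp N hN δ₂ δ₃ δ₅ hδ₂ hδ₃ hδ₅ α β hyp
  have hp2 : (2 : ℝ) ≤ p := by exact_mod_cast hp.two_le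
  have hp1 : (1 : ℝ) ≤ p := by linarith
  have hp0 : (0 : ℝ) < p := by linarith
  have hN0 : 0 < N := by linarith
  set M := ⌊N⌋₊ with hM
  have hMN : (M : ℝ) ≤ N := Nat.floor_le hN0.le
  have hcard : (Set.ncard {n : ℤ | 1 ≤ n ∧ (n : ℝ) ≤ N ∧
      nint (α * (n : ℝ)^2 + β) ≤ 8 * N / p} : ℝ) ≤
      (((range M).filter (fun n : ℕ => nint (α * ((n : ℝ) + 1) ^ 2 + β) ≤ 8 * N / p)).card : ℝ) := by
    have hsub : {n : ℤ | 1 ≤ n ∧ (n : ℝ) ≤ N ∧ nint (α * (n : ℝ)^2 + β) ≤ 8 * N / p} ⊆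
        ((((range M).filter (fun n : ℕ => nint (α * ((n : ℝ) + 1) ^ 2 + β) ≤ 8 * N / p)).image
          (fun n : ℕ => (n : ℤ) + 1) : Finset ℤ) : Set ℤ) := by
      rintro n ⟨h1, h2, h3⟩
      rw [mem_coe, mem_image]
      obtain ⟨m, hm⟩ := Int.eq_ofNat_of_zero_le (show 0 ≤ n - 1 by omega)
      have hn : n = (m : ℤ) + 1 := by omega
      subst hn
      refine ⟨m, ?_, rfl⟩
      rw [mem_filter, mem_range]
      refine ⟨?_, by push_cast at h3; exact h3⟩
      have : m + 1 ≤ M := Nat.le_floor (by push_cast at h2 ⊢; exact h2)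
      omega
    have h1 := Set.ncard_le_ncard hsub (Finset.finite_toSet _)
    rw [Set.ncard_coe_finset] at h1
    exact_mod_cast h1.trans card_image_le
  refine hcard.trans ?_
  have t1 : 0 ≤ N ^ 2 / p := by positivity
  have t2 : 0 ≤ N * (p : ℝ) ^ (-δ₅) := by positivity
  have t3 : 0 ≤ N ^ ((1 : ℝ) + ε) * (p : ℝ) ^ (-δ₂/2 + ε) := by positivity
  have t4 : 0 ≤ N ^ ((1 : ℝ)/2 + ε) * (p : ℝ) ^ ε := by positivity
  have t5 : 0 ≤ (p : ℝ) ^ (δ₃/2 + ε) := by positivity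
  have hsK : 0 ≤ √K := Real.sqrt_nonneg _
  by_cases hbig : (p : ℝ) / (48 * N) < 1
  · have h1 : (((range M).filter (fun n : ℕ =>
        nint (α * ((n : ℝ) + 1) ^ 2 + β) ≤ 8 * N / p)).card : ℝ) ≤ M := by
      have := card_filter_le (range M) (fun n : ℕ => nint (α * ((n : ℝ) + 1) ^ 2 + β) ≤ 8 * N / p)
      rw [card_range] at this
      exact_mod_cast this
    have h2 : N ≤ 48 * (N ^ 2 / p) := by
      rw [div_lt_one (by positivity)] at hbig
      rw [← mul_div_assoc, le_div_iff₀ hp0]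
      nlinarith
    calc _ ≤ 48 * (N ^ 2 / p) := h1.trans (hMN.trans h2)
      _ ≤ (784 + 8 * √K) * (N ^ 2 / p) := by gcongr; linarith
      _ ≤ _ := by gcongr; linarith
  push Not at hbig
  have hpδ : (1 : ℝ) ≤ (p : ℝ) ^ δ₅ := Real.one_le_rpow hp1 hδ₅.1.le
  set m := min ((p : ℝ) / (48 * N)) ((p : ℝ) ^ δ₅) with hm
  have hm1 : 1 ≤ m := le_min hbig hpδ
  set H := ⌊m⌋₊ with hH
  have hH1 : 1 ≤ H := Nat.le_floor (by simpa using hm1)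
  have hHR : (1 : ℝ) ≤ H := by exact_mod_cast hH1
  have hHm : (H : ℝ) ≤ m := Nat.floor_le (by linarith)
  have hHm2 : m < H + 1 := Nat.lt_floor_add_one m
  have hinv : 1 / (H : ℝ) ≤ 2 * (48 * N / p + (p : ℝ) ^ (-δ₅)) := by
    have h1 : 1 / (H : ℝ) ≤ 2 * (1 / m) := by
      rw [← mul_div_assoc, div_le_div_iff₀ (by linarith) (by linarith)]
      linarith
    refine h1.trans ?_
    gcongr
    have hq : 0 ≤ 48 * N / p := by positivity
    have hq2 : 0 ≤ (p : ℝ) ^ (-δ₅) := by positivity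
    rcases min_choice ((p : ℝ) / (48 * N)) ((p : ℝ) ^ δ₅) with h | h
    · rw [hm, h, one_div_div]; linarith
    · rw [hm, h, one_div, ← Real.rpow_neg hp0.le]; linarith
  set X := N * (p : ℝ) ^ (-δ₂/2) with hX
  set Y := N ^ ((1 : ℝ)/2) with hY
  set Z := (p : ℝ) ^ (δ₃/2) with hZ
  have hX0 : 0 ≤ X := by positivity
  have hY0 : 0 ≤ Y := by positivity
  have hZ0 : 0 ≤ Z := by positivity
  set B := √K * (p : ℝ) ^ ε * (X + Y + Z) with hB
  have hB0 : 0 ≤ B := by positivity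
  have hX2 : X ^ 2 = N ^ 2 * (p : ℝ) ^ (-δ₂) := by
    rw [hX, mul_pow, ← Real.rpow_natCast ((p : ℝ) ^ (-δ₂/2)), ← Real.rpow_mul hp0.le]
    congr 2; push_cast; ring
  have hY2 : Y ^ 2 = N := by
    rw [hY, ← Real.rpow_natCast, ← Real.rpow_mul hN0.le]; norm_num
  have hZ2 : Z ^ 2 = (p : ℝ) ^ δ₃ := by
    rw [hZ, ← Real.rpow_natCast, ← Real.rpow_mul hp0.le]; congr 1; push_cast; ring
  have hP2 : ((p : ℝ) ^ ε) ^ 2 = (p : ℝ) ^ (2 * ε) := by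
    rw [← Real.rpow_natCast, ← Real.rpow_mul hp0.le]; congr 1; push_cast; ring
  have hmain := WeylAux.count_bound (fun n : ℕ => α * ((n : ℝ) + 1) ^ 2 + β) M H hH1 (8 * N / p) B
    (by
      have h1 : (H : ℝ) ≤ p / (48 * N) := hHm.trans (min_le_left _ _)
      rw [le_div_iff₀ (by positivity)] at h1
      rw [div_mul_eq_mul_div, div_le_one hp0]
      linarith) hB0
    (by
      intro k hk1 hkH
      have hkp : ((k : ℤ) : ℝ) ≤ (p : ℝ) ^ δ₅ := by
        have h1 : (k : ℝ) ≤ H := by exact_mod_cast hkH.le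
        push_cast
        exact h1.trans (hHm.trans (min_le_right _ _))
      obtain ⟨a, b, hab, hb1, hb2, happ⟩ := hyp k (by exact_mod_cast hk1) hkp
      have hb0 : (0 : ℝ) < b := lt_of_lt_of_le (by positivity) hb1
      have hbZ : 0 < b := by exact_mod_cast hb0
      lift b to ℕ using hbZ.le
      push_cast at hb0 hb1 hb2 happ
      have hbN : 0 < b := by exact_mod_cast hbZ
      have hw := WeylAux.weyl (θ := k * α) (γ := k * β) hbN hab happ M
      have hsum : ∑ n ∈ range M, WeylAux.e (k * (α * ((n : ℝ) + 1) ^ 2 + β)) =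
          ∑ n ∈ range M, WeylAux.e (k * α * ((n : ℝ) + 1) ^ 2 + k * β) := by
        apply sum_congr rfl; intro n _; congr 1; ring
      rw [hsum]
      apply le_of_sq_le_sq _ hB0
      refine hw.trans ?_
      have hb1' : (1 : ℝ) ≤ b := by exact_mod_cast hbN
      have hbp : (b : ℝ) ≤ p := hb2.trans (by
        calc (p : ℝ) ^ δ₃ ≤ (p : ℝ) ^ (1 : ℝ) := Real.rpow_le_rpow_of_exponent_le hp1 hδ₃.2.le
          _ = p := Real.rpow_one _)
      have hlog0 : 0 ≤ Real.log (2 * b) := Real.log_nonneg (by linarith)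
      have hlog : Real.log (2 * b) ≤ 2 * Real.log p := by
        have : Real.log (2 * b) ≤ Real.log ((p : ℝ) ^ 2) :=
          Real.log_le_log (by positivity) (by nlinarith)
        rwa [Real.log_pow] at this
      have hlogp : Real.log p ≤ (p : ℝ) ^ (2 * ε) / (2 * ε) :=
        Real.log_le_rpow_div hp0.le (by positivity)
      have hpe : (1 : ℝ) ≤ (p : ℝ) ^ (2 * ε) := Real.one_le_rpow hp1 (by positivity)
      set Λ := 1 + Real.log (2 * b) with hΛ
      have hΛ1 : 1 ≤ Λ := by linarith
      have hΛ2 : Λ ≤ (1 + 1 / ε) * (p : ℝ) ^ (2 * ε) := by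
        have : 2 * ((p : ℝ) ^ (2 * ε) / (2 * ε)) = 1 / ε * (p : ℝ) ^ (2 * ε) := by
          field_simp
        rw [add_mul]
        linarith
      have hM0 : (0 : ℝ) ≤ M := by positivity
      have e1 : 2 * ((4 * M / b + 1) * (2 * (M + b * Λ))) =
          16 * ((M : ℝ) ^ 2 / b) + 16 * M * Λ + 4 * M + 4 * b * Λ := by
        field_simp; ring
      have e2 : (M : ℝ) ^ 2 / b ≤ X ^ 2 := by
        rw [hX2, Real.rpow_neg hp0.le, ← div_eq_mul_inv]
        gcongr
      have e3 : (M : ℝ) ≤ Y ^ 2 := by rw [hY2]; exact hMN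
      have e4 : (b : ℝ) ≤ Z ^ 2 := by rw [hZ2]; exact hb2
      have e5 : 16 * ((M : ℝ) ^ 2 / b) + 16 * M * Λ + 4 * M + 4 * b * Λ ≤
          20 * Λ * (X ^ 2 + Y ^ 2 + Z ^ 2) := by
        have f1 : (M : ℝ) ^ 2 / b ≤ Λ * X ^ 2 :=
          e2.trans (le_mul_of_one_le_left (sq_nonneg X) hΛ1)
        have f2 : M * Λ ≤ Λ * Y ^ 2 := by rw [mul_comm]; gcongr
        have f3 : (M : ℝ) ≤ Λ * Y ^ 2 := e3.trans (le_mul_of_one_le_left (sq_nonneg Y) hΛ1)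
        have f4 : b * Λ ≤ Λ * Z ^ 2 := by rw [mul_comm]; gcongr
        have f5 : 0 ≤ Λ * X ^ 2 := by positivity
        have f6 : 0 ≤ Λ * Z ^ 2 := by positivity
        linarith
      rw [e1]
      refine e5.trans ?_
      have e6 : B ^ 2 = K * (p : ℝ) ^ (2 * ε) * (X + Y + Z) ^ 2 := by
        rw [hB, mul_pow, mul_pow, Real.sq_sqrt hKpos.le, hP2]
      rw [e6]
      have e7 : X ^ 2 + Y ^ 2 + Z ^ 2 ≤ (X + Y + Z) ^ 2 := by
        nlinarith [mul_nonneg hX0 hY0, mul_nonneg hX0 hZ0, mul_nonneg hY0 hZ0]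
      have e8 : 20 * Λ ≤ K * (p : ℝ) ^ (2 * ε) := by rw [hK]; linarith
      exact mul_le_mul e8 e7 (by positivity) (by positivity))
  refine hmain.trans ?_
  have g1 : 8 * M / (H : ℝ) ≤ 768 * (N ^ 2 / p) + 16 * (N * (p : ℝ) ^ (-δ₅)) := by
    calc 8 * M / (H : ℝ) = 8 * M * (1 / H) := by ring
      _ ≤ 8 * N * (2 * (48 * N / p + (p : ℝ) ^ (-δ₅))) := by gcongr
      _ = _ := by ring
  have hNε : 1 ≤ N ^ ε := Real.one_le_rpow hN hε.le
  have g2 : (p : ℝ) ^ ε * X ≤ N ^ ((1 : ℝ) + ε) * (p : ℝ) ^ (-δ₂/2 + ε) := by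
    rw [Real.rpow_add hN0, Real.rpow_add hp0, Real.rpow_one]
    calc (p : ℝ) ^ ε * X = (p : ℝ) ^ ε * X * 1 := by ring
      _ ≤ (p : ℝ) ^ ε * X * N ^ ε := by gcongr
      _ = _ := by rw [hX]; ring
  have g3 : (p : ℝ) ^ ε * Y ≤ N ^ ((1 : ℝ)/2 + ε) * (p : ℝ) ^ ε := by
    rw [Real.rpow_add hN0]
    calc (p : ℝ) ^ ε * Y = (p : ℝ) ^ ε * Y * 1 := by ring
      _ ≤ (p : ℝ) ^ ε * Y * N ^ ε := by gcongr
      _ = _ := by rw [hY]; ring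
  have g4 : (p : ℝ) ^ ε * Z = (p : ℝ) ^ (δ₃/2 + ε) := by
    rw [Real.rpow_add hp0, hZ]; ring
  have g5 : B ≤ √K * (N ^ ((1 : ℝ) + ε) * (p : ℝ) ^ (-δ₂/2 + ε)
          + N ^ ((1 : ℝ)/2 + ε) * (p : ℝ) ^ ε + (p : ℝ) ^ (δ₃/2 + ε)) := by
    have : B = √K * ((p : ℝ) ^ ε * X + (p : ℝ) ^ ε * Y + (p : ℝ) ^ ε * Z) := by rw [hB]; ring
    rw [this]
    gcongr
    exact g4.le
  generalize N ^ ((1 : ℝ) + ε) * (p : ℝ) ^ (-δ₂/2 + ε) = T3 at *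
  generalize N ^ ((1 : ℝ)/2 + ε) * (p : ℝ) ^ ε = T4 at *
  generalize (p : ℝ) ^ (δ₃/2 + ε) = T5 at *
  generalize N * (p : ℝ) ^ (-δ₅) = T2 at *
  generalize N ^ 2 / p = T1 at *
  have w1 : 0 ≤ √K * T1 := by positivity
  have w2 : 0 ≤ √K * T2 := by positivity
  linarith
end
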